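/- arXiv:1311.3166 — 11 statements merged into one kernel-verified Lean document; each statement's English description precedes it below -/
import Mathlib

section
/- Every bounded pure subgroup M of an abelian group N is a direct summand of N: there exists a subgroup P of N with N = M ⊕ P. -/
/-- `M` stays pure (and disjoint) modulo `P`. -/
def PureMod {N : Type*} [AddCommGroup N] (M P : AddSubgroup N) : Prop :=
  ∀ m : ℕ, 1 ≤ m → ∀ x ∈ M, ∀ y : N, m • y - x ∈ P → ∃ z ∈ M, m • z = x

theorem pureMod_zmultiples {N : Type*} [AddCommGroup N] (M : AddSubgroup N)
    (hpure : ∀ m : ℕ, 1 ≤ m → ∀ x ∈ M, (∃ y : N, m • y = x) → ∃ z ∈ M, m • z = x)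
    (p k : ℕ) (hp : p.Prime) (b : N) (hb : p ^ k • b ∉ M) (hb0 : p ^ (k + 1) • b = 0)
    (hmax : ∀ k' b', p ^ k' • b' ∉ M → p ^ (k' + 1) • b' = (0 : N) → k' ≤ k) :
    PureMod M (AddSubgroup.zmultiples b) := by
  intro m hm x hx y hy
  have hfin : IsOfFinAddOrder b :=
    isOfFinAddOrder_iff_nsmul_eq_zero.2 ⟨_, pow_pos hp.pos _, hb0⟩
  rw [← hfin.mem_multiples_iff_mem_zmultiples, AddSubmonoid.mem_multiples_iff] at hy
  obtain ⟨c, hc⟩ := hy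
  apply hpure m hm x hx
  suffices h : ∃ w : N, m • w = c • b by
    obtain ⟨w, hw⟩ := h
    exact ⟨y - w, by rw [smul_sub, hw, hc]; abel⟩
  by_cases hck : p ^ (k + 1) ∣ c
  · obtain ⟨d, rfl⟩ := hck
    exact ⟨0, by rw [mul_comm, mul_smul, hb0]; simp⟩
  have hc0 : c ≠ 0 := by rintro rfl; exact hck (dvd_zero _)
  obtain ⟨i, u, hu, rfl⟩ := Nat.exists_eq_pow_mul_and_not_dvd hc0 p hp.ne_one
  obtain ⟨j, m', hm', rfl⟩ := Nat.exists_eq_pow_mul_and_not_dvd (by omega : m ≠ 0) p hp.ne_one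
  have hik : i ≤ k := by
    by_contra h
    exact hck (Dvd.dvd.mul_right (pow_dvd_pow p (by omega)) u)
  by_cases hij : j ≤ i
  · have hcop : IsCoprime (m' : ℤ) ((p ^ (k + 1) : ℕ) : ℤ) := by
      rw [Nat.isCoprime_iff_coprime]
      exact (Nat.Coprime.pow_right _ ((hp.coprime_iff_not_dvd.2 hm').symm))
    obtain ⟨s, t, hst⟩ := hcop
    obtain ⟨r, rfl⟩ := Nat.exists_eq_add_of_le hij
    refine ⟨s • (p ^ r * u) • b, ?_⟩
    have hb1 : ((p ^ (k + 1) : ℕ) : ℤ) • b = 0 := by rw [natCast_zsmul, hb0]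
    have h1 : b = (s * m') • b := by
      have : (s * m' + t * ((p ^ (k + 1) : ℕ) : ℤ)) • b = b := by rw [hst, one_smul]
      rw [add_smul, mul_smul t, hb1, smul_zero, add_zero] at this
      exact this.symm
    conv_rhs => rw [h1]
    simp only [← natCast_zsmul, ← mul_smul]
    congr 1
    push_cast
    ring
  · exfalso
    obtain ⟨r, rfl⟩ := Nat.exists_eq_add_of_le hik
    -- k = i + r
    obtain ⟨z, hz, hzx⟩ := hpure (p ^ (j + r + 1) * m')
      (Nat.pos_of_ne_zero (by
        refine mul_ne_zero (pow_ne_zero _ hp.ne_zero) ?_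
        rintro rfl; exact hm' (dvd_zero _))) (p ^ (r + 1) • x) (M.nsmul_mem hx _)
      ⟨y, by
        have h2 : p ^ (r + 1) • ((p ^ i * u) • b) = 0 := by
          rw [← mul_smul, show p ^ (r + 1) * (p ^ i * u) = u * p ^ (i + r + 1) by ring,
            mul_smul, hb0, smul_zero]
        rw [hc, smul_sub, ← mul_smul, sub_eq_zero] at h2
        rw [← h2]; congr 1; ring⟩
    have hkey : p ^ (j + r) • (m' • (y - z)) =
        p ^ r • x + u • (p ^ (i + r) • b) - (p ^ (j + r) * m') • z := by
      have h3 : p ^ r • ((p ^ i * u) • b) = p ^ r • ((p ^ j * m') • y - x) := by rw [hc]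
      have h4 : u • (p ^ (i + r) • b) = p ^ r • ((p ^ i * u) • b) := by
        rw [← mul_smul, ← mul_smul]; congr 1; ring
      rw [h4, h3]
      simp only [smul_sub, ← mul_smul]
      rw [show p ^ r * (p ^ j * m') = p ^ (j + r) * m' by ring]
      abel
    have := hmax (j + r) (m' • (y - z)) ?_ ?_
    · omega
    · rw [hkey]
      intro hmem
      have h5 : u • (p ^ (i + r) • b) ∈ M := by
        have := M.sub_mem (M.add_mem hmem (M.nsmul_mem hz (p ^ (j + r) * m')))
          (M.nsmul_mem hx (p ^ r))
        convert this using 1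
        abel
      have hcop : IsCoprime (u : ℤ) (p : ℤ) := by
        rw [Nat.isCoprime_iff_coprime]
        exact (hp.coprime_iff_not_dvd.2 hu).symm
      obtain ⟨s, t, hst⟩ := hcop
      apply hb
      have h6 : (s * u + t * p) • (p ^ (i + r) • b) = p ^ (i + r) • b := by rw [hst, one_smul]
      rw [← h6, add_smul, mul_smul, mul_smul, natCast_zsmul, natCast_zsmul]
      have h7 : p • p ^ (i + r) • b = 0 := by
        rw [← mul_smul, ← hb0]; congr 1; ring
      rw [h7, smul_zero, add_zero]
      exact M.zsmul_mem h5 s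
    · have h8 : p ^ (j + r + 1) • (m' • (y - z)) = p • (p ^ (j + r) • (m' • (y - z))) := by
        rw [pow_succ', mul_smul]
      rw [h8, hkey, smul_sub, smul_add]
      have h7 : p • u • p ^ (i + r) • b = 0 := by
        rw [← mul_smul, ← mul_smul, show p * u * p ^ (i + r) = u * p ^ (i + r + 1) by ring,
          mul_smul, hb0, smul_zero]
      rw [h7, add_zero, ← mul_smul, ← mul_smul, sub_eq_zero,
        show p * p ^ r = p ^ (r + 1) by ring, ← hzx]
      congr 1; ring

theorem exists_pureMod {N : Type*} [AddCommGroup N] (M : AddSubgroup N)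
    (n : ℕ) (hn : 1 ≤ n) (hM : ∀ x ∈ M, n • x = (0 : N))
    (hpure : ∀ m : ℕ, 1 ≤ m → ∀ x ∈ M, (∃ y : N, m • y = x) → ∃ z ∈ M, m • z = x)
    (hne : M ≠ ⊤) : ∃ P : AddSubgroup N, P ≠ ⊥ ∧ PureMod M P := by
  by_cases hnN : ∀ y : N, n • y = 0
  swap
  · push Not at hnN
    obtain ⟨y, hy⟩ := hnN
    refine ⟨(nsmulAddMonoidHom (α := N) n).range, ?_, ?_⟩
    · intro h
      have : n • y ∈ (nsmulAddMonoidHom (α := N) n).range := ⟨y, rfl⟩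
      rw [h] at this
      exact hy this
    · rintro m hm x hx y ⟨w, hw⟩
      have hw' : n • w = m • y - x := hw
      obtain ⟨z, hz, hzx⟩ := hpure (Nat.gcd m n) (Nat.gcd_pos_of_pos_left _ hm) x hx
        ⟨(m / Nat.gcd m n) • y - (n / Nat.gcd m n) • w, by
          rw [smul_sub, ← mul_smul, ← mul_smul, Nat.mul_div_cancel' (Nat.gcd_dvd_left m n),
            Nat.mul_div_cancel' (Nat.gcd_dvd_right m n), hw']
          abel⟩
      refine ⟨Nat.gcdA m n • z, M.zsmul_mem hz _, ?_⟩
      rw [← hzx, ← natCast_zsmul z, Nat.gcd_eq_gcd_ab, add_smul, mul_smul, mul_comm (n : ℤ),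
        mul_smul, natCast_zsmul, natCast_zsmul, hM z hz, smul_zero, add_zero]
  obtain ⟨a, ha⟩ : ∃ a, a ∉ M := by
    by_contra h
    push Not at h
    exact hne (eq_top_iff.2 fun x _ => h x)
  classical
  have hex : ∃ d : ℕ, 1 ≤ d ∧ d • a ∈ M := ⟨n, hn, by rw [hnN]; exact M.zero_mem⟩
  obtain ⟨hd1, hd2⟩ := Nat.find_spec hex
  have hdmin := fun d' => @Nat.find_min _ _ hex d'
  generalize Nat.find hex = d at hd1 hd2 hdmin
  have hdne : d ≠ 1 := by rintro rfl; exact ha (by simpa using hd2)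
  obtain ⟨p, hp, e, rfl⟩ := Nat.exists_prime_and_dvd hdne
  have he : 1 ≤ e := Nat.pos_of_ne_zero (by rintro rfl; simp at hd1)
  have hea : e • a ∉ M := fun h =>
    hdmin e (by nlinarith [hp.two_le]) ⟨he, h⟩
  obtain ⟨z, hz, hzx⟩ := hpure p hp.one_le _ hd2 ⟨e • a, by rw [mul_smul]⟩
  let S : Set ℕ := {k | ∃ b : N, p ^ k • b ∉ M ∧ p ^ (k + 1) • b = 0}
  have hS0 : S.Nonempty := by
    refine ⟨0, e • a - z, ?_, ?_⟩
    · rw [pow_zero, one_smul]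
      intro h
      exact hea (by simpa using M.add_mem h hz)
    · rw [zero_add, pow_one, smul_sub, hzx, mul_smul, sub_self]
  have hSb : BddAbove S := by
    refine ⟨n, ?_⟩
    rintro k ⟨b, hb, hb0⟩
    haveI := Fact.mk hp
    have ho : addOrderOf b = p ^ (k + 1) :=
      addOrderOf_eq_prime_pow (fun h => hb (by rw [h]; exact M.zero_mem)) hb0
    have h1 : p ^ (k + 1) ∣ n := ho ▸ addOrderOf_dvd_of_nsmul_eq_zero (hnN b)
    have h2 := Nat.le_of_dvd hn h1
    have h3 := Nat.lt_pow_self hp.one_lt (n := k + 1)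
    omega
  obtain ⟨b, hb, hb0⟩ := Nat.sSup_mem hS0 hSb
  refine ⟨AddSubgroup.zmultiples b, ?_, pureMod_zmultiples M hpure p _ hp b hb hb0 ?_⟩
  · intro h
    rw [AddSubgroup.zmultiples_eq_bot] at h
    exact hb (by rw [h, smul_zero]; exact M.zero_mem)
  · intro k' b' h1 h2
    exact le_csSup hSb ⟨b', h1, h2⟩

/-- Every bounded pure subgroup `M` of an abelian group `N` is a
direct summand of `N`: there is a subgroup `P` of `N` with `N = M ⊕ P` (i.e. `M` and `P`
are complementary: `M ⊓ P = ⊥` and `M ⊔ P = ⊤`).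
Here `M` is bounded means `n • M = 0` for some `n ≥ 1`, and `M` is pure means
`M ∩ mN = mM` for all `m ≥ 1`. -/
theorem bounded_pure_subgroup_is_direct_summand
    (N : Type*) [AddCommGroup N] (M : AddSubgroup N)
    (hbound : ∃ n : ℕ, 1 ≤ n ∧ ∀ x ∈ M, n • x = (0 : N))
    (hpure : ∀ m : ℕ, 1 ≤ m → ∀ x ∈ M, (∃ y : N, m • y = x) → ∃ z ∈ M, m • z = x) :
    ∃ P : AddSubgroup N, IsCompl M P := by
  obtain ⟨n, hn, hM⟩ := hbound
  obtain ⟨P, hP⟩ : ∃ P : AddSubgroup N, Maximal (· ∈ {P | PureMod M P}) P := by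
    apply zorn_le₀
    intro c hc hchain
    by_cases hne : c.Nonempty
    · refine ⟨sSup c, ?_, fun P hP => le_sSup hP⟩
      intro m hm x hx y hy
      rw [AddSubgroup.mem_sSup_of_directedOn hne hchain.directedOn] at hy
      obtain ⟨P, hPc, hyP⟩ := hy
      exact hc hPc m hm x hx y hyP
    · refine ⟨⊥, ?_, fun P hP => (hne ⟨P, hP⟩).elim⟩
      intro m hm x hx y hy
      exact hpure m hm x hx ⟨y, sub_eq_zero.1 hy⟩
  have hPm : PureMod M P := hP.prop
  have hdisj : ∀ x ∈ M, x ∈ P → x = 0 := by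
    intro x hx hxP
    obtain ⟨z, hz, rfl⟩ := hPm n hn x hx 0 (by simpa using hxP)
    exact hM z hz
  refine ⟨P, ?_⟩
  constructor
  · rw [AddSubgroup.disjoint_def]
    exact fun {x} hx hxP => hdisj x hx hxP
  rw [codisjoint_iff]
  by_contra hcon
  let f := QuotientAddGroup.mk' P
  have hf : ∀ x, f x = 0 ↔ x ∈ P := fun x => QuotientAddGroup.eq_zero_iff x
  have hfs : Function.Surjective f := QuotientAddGroup.mk'_surjective P
  obtain ⟨R, hR, hRm⟩ := exists_pureMod (M.map f) n hn
    (by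
      rintro _ ⟨x, hx, rfl⟩
      rw [← map_nsmul, hM x hx, map_zero])
    (by
      rintro m hm _ ⟨x, hx, rfl⟩ ⟨y, hy⟩
      obtain ⟨y, rfl⟩ := hfs y
      obtain ⟨z, hz, hzx⟩ := hPm m hm x hx y (by
        rw [← hf, map_sub, map_nsmul, hy, sub_self])
      exact ⟨f z, ⟨z, hz, rfl⟩, by rw [← map_nsmul, hzx]⟩)
    (by
      intro h
      apply hcon
      rw [eq_top_iff]
      intro y _
      obtain ⟨x, hx, hxy⟩ : f y ∈ M.map f := h ▸ AddSubgroup.mem_top _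
      rw [AddSubgroup.mem_sup]
      exact ⟨x, hx, y - x, by rw [← hf, map_sub, hxy, sub_self], by abel⟩)
  have hle : P ≤ R.comap f := fun x hx => by
    rw [AddSubgroup.mem_comap, (hf x).2 hx]; exact R.zero_mem
  have hQ : PureMod M (R.comap f) := by
    intro m hm x hx y hy
    rw [AddSubgroup.mem_comap, map_sub, map_nsmul] at hy
    obtain ⟨_, ⟨z, hz, rfl⟩, hzx⟩ := hRm m hm (f x) ⟨x, hx, rfl⟩ (f y) hy
    refine ⟨z, hz, sub_eq_zero.1 (hdisj _ (M.sub_mem (M.nsmul_mem hz m) hx) ?_)⟩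
    rw [← hf, map_sub, map_nsmul, hzx, sub_self]
  have hge : R.comap f ≤ P := hP.le_of_ge hQ hle
  apply hR
  rw [eq_bot_iff]
  intro w hw
  obtain ⟨x, rfl⟩ := hfs w
  exact (hf x).2 (hge hw)
end

section
/- Let M be a subgroup of an abelian group N and let ℓⁿ be a prime power. If M ∩ ℓⁿN = 0 and M is maximal among the subgroups of N with this property (i.e., for every subgroup M' of N with M ⊆ M' and M' ∩ ℓⁿN = 0 one has M' = M), then M is a direct summand of N. -/
theorem aux_pure {N : Type*} [AddCommGroup N] (M : AddSubgroup N) (l : ℤ) (hl : Prime l) (n : ℕ)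
    (hcap : ∀ x ∈ M, ∀ y : N, x = l ^ n • y → x = 0)
    (hmax : ∀ z : N, z ∉ M → ∃ m ∈ M, ∃ k : ℤ, ∃ w : N, m + k • z = l ^ n • w ∧ m + k • z ≠ 0) :
    ∀ j, j ≤ n → ∀ m ∈ M, ∀ y : N, m = l ^ j • y → ∃ m' ∈ M, m = l ^ j • m' := by
  intro j
  induction j with
  | zero => intro _ m hm y _; exact ⟨m, hm, by simp⟩
  | succ j ih =>
    intro hj m hm y hy
    by_cases hz : l ^ j • y ∈ M
    · obtain ⟨m', hm', h⟩ := ih (by omega) _ hz y rfl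
      refine ⟨m', hm', ?_⟩
      rw [hy, pow_succ', mul_smul, h, mul_smul]
    · obtain ⟨m0, hm0, k, w, h1, h2⟩ := hmax _ hz
      have hlz : l • l ^ j • y = m := by rw [hy, pow_succ', mul_smul]
      have hk : ¬ l ∣ k := by
        rintro ⟨k', rfl⟩
        refine h2 (hcap _ ?_ w h1)
        refine M.add_mem hm0 ?_
        rw [mul_comm, mul_smul, hlz]
        exact M.zsmul_mem hm _
      obtain ⟨a, b, hab⟩ : IsCoprime l k := (hl.coprime_iff_not_dvd).2 hk
      -- z = a l z + b k z
      have hzeq : l ^ j • y = (a • m - b • m0) + l ^ n • (b • w) := by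
        have h3 : k • l ^ j • y = l ^ n • w - m0 := by rw [← h1]; abel
        calc l ^ j • y = (a * l + b * k) • l ^ j • y := by rw [hab, one_smul]
          _ = a • (l • l ^ j • y) + b • (k • l ^ j • y) := by module
          _ = _ := by rw [hlz, h3]; module
      have hm1 : a • m - b • m0 ∈ M := M.sub_mem (M.zsmul_mem hm _) (M.zsmul_mem hm0 _)
      obtain ⟨c, rfl⟩ := Nat.exists_eq_add_of_le (show j ≤ n by omega)
      obtain ⟨m2, hm2, h4⟩ := ih (by omega) _ hm1 (y - l ^ c • b • w) (by
        rw [smul_sub, hzeq, pow_add]; module)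
      refine ⟨m2, hm2, ?_⟩
      have h5 : m - l ^ (j+1) • m2 = 0 := by
        refine hcap _ (M.sub_mem hm (M.zsmul_mem hm2 _)) (l • b • w) ?_
        rw [← hlz, hzeq, h4]; module
      exact sub_eq_zero.1 h5

theorem aux_ext {N : Type*} [AddCommGroup N] (M P : AddSubgroup N) (l : ℤ) (hl : Prime l) (n : ℕ)
    (hn : ∀ y : N, l ^ n • y ∈ P)
    (hC : ∀ m ∈ M, ∀ p ∈ P, ∀ (y : N) (j : ℕ), m + p = l ^ j • y → ∃ m' ∈ M, m = l ^ j • m')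
    (hne : M ⊔ P ≠ ⊤) :
    ∃ x, x ∉ P ∧ ∀ m ∈ M, ∀ p ∈ P ⊔ AddSubgroup.zmultiples x, ∀ (y : N) (j : ℕ),
      m + p = l ^ j • y → ∃ m' ∈ M, m = l ^ j • m' := by
  classical
  have hex : ∃ e : ℕ, ∀ y : N, l ^ e • y ∈ M ⊔ P := ⟨n, fun y => AddSubgroup.mem_sup_right (hn y)⟩
  obtain ⟨e, he, hmin⟩ : ∃ e : ℕ, (∀ y : N, l ^ e • y ∈ M ⊔ P) ∧
      ∀ i < e, ¬ ∀ y : N, l ^ i • y ∈ M ⊔ P :=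
    ⟨Nat.find hex, Nat.find_spec hex, fun i hi => Nat.find_min hex hi⟩
  obtain _ | e := e
  · exact absurd (eq_top_iff.2 fun y _ => by simpa using he y) hne
  have := hmin e (by omega)
  push Not at this
  obtain ⟨x0, hx0⟩ := this
  obtain ⟨m, hm, p, hp, hmp⟩ := AddSubgroup.mem_sup.1 (he x0)
  obtain ⟨m', hm', rfl⟩ := hC m hm p hp _ _ hmp
  obtain ⟨x, rfl⟩ : ∃ x, x0 = x + m' := ⟨x0 - m', by abel⟩
  have hx : l ^ e • x ∉ M ⊔ P := fun h => hx0 (by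
    rw [smul_add]
    exact add_mem h (AddSubgroup.mem_sup_left (M.zsmul_mem hm' _)))
  have hxp : l ^ (e+1) • x ∈ P := by
    have : l ^ (e+1) • x = p := by
      rw [smul_add, add_comm] at hmp
      exact (add_right_cancel hmp).symm
    rwa [this]
  have key : ∀ k : ℤ, k • x ∈ M ⊔ P → l ^ (e+1) ∣ k := by
    intro k hk
    have hd : ((Int.gcd (l ^ (e+1)) k : ℕ) : ℤ) • x ∈ M ⊔ P := by
      rw [Int.gcd_eq_gcd_ab, add_smul, mul_comm, mul_smul, mul_comm k, mul_smul]
      exact add_mem (AddSubgroup.zsmul_mem _ (AddSubgroup.mem_sup_right hxp) _)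
        (AddSubgroup.zsmul_mem _ hk _)
    obtain ⟨i, hi, hass⟩ := (dvd_prime_pow hl (e+1)).1 (Int.gcd_dvd_left (l ^ (e+1)) k)
    rcases Nat.lt_or_ge e i with h | h
    · obtain rfl : i = e + 1 := by omega
      exact hass.symm.dvd.trans (Int.gcd_dvd_right _ _)
    · exfalso
      obtain ⟨c, hc⟩ := hass.dvd.trans (pow_dvd_pow l h)
      rw [hc, mul_comm, mul_smul] at hx
      exact hx (AddSubgroup.zsmul_mem _ hd _)
  refine ⟨x, fun h => hx (AddSubgroup.zsmul_mem _ (AddSubgroup.mem_sup_right h) _), ?_⟩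
  intro m hm q hq y j h
  obtain ⟨p, hp, r, hr, rfl⟩ := AddSubgroup.mem_sup.1 hq
  obtain ⟨k, rfl⟩ := AddSubgroup.mem_zmultiples_iff.1 hr
  have hmpS : m + p ∈ M ⊔ P := AddSubgroup.add_mem_sup hm hp
  have hkx : k • x = l ^ j • y - (m + p) := by rw [← h]; abel
  rcases Nat.lt_or_ge j (e+1) with hj | hj
  · obtain ⟨c, hc⟩ := Nat.exists_eq_add_of_lt hj
    have h1 : (l ^ (c+1) * k) • x ∈ M ⊔ P := by
      have : (l ^ (c+1) * k) • x = l ^ (e+1) • y - l ^ (c+1) • (m + p) := by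
        rw [mul_smul, hkx, hc]; module
      rw [this]
      exact sub_mem (he y) (AddSubgroup.zsmul_mem _ hmpS _)
    have h2 := key _ h1
    rw [hc, show j + c + 1 = (c + 1) + j by omega, pow_add] at h2
    obtain ⟨k', rfl⟩ := (mul_dvd_mul_iff_left (pow_ne_zero _ hl.ne_zero)).1 h2
    refine hC m hm p hp (y - k' • x) j ?_
    rw [smul_sub, ← h]; module
  · obtain ⟨c, rfl⟩ := Nat.exists_eq_add_of_le hj
    have h1 : k • x ∈ M ⊔ P := by
      rw [hkx]
      refine sub_mem ?_ hmpS
      rw [pow_add, mul_smul]; exact he _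
    obtain ⟨k', rfl⟩ := key _ h1
    refine hC m hm _ (add_mem hp ?_) y _ h
    rw [mul_comm, mul_smul]
    exact AddSubgroup.zsmul_mem _ hxp _

/-- Let `M` be a subgroup of an abelian group `N` and `ℓ ^ n` a prime
power.  If `M ∩ ℓⁿN = 0` and `M` is maximal among the subgroups of `N` with this
property, then `M` is a direct summand of `N`. -/
theorem maximal_subgroup_meeting_power_trivially_is_summand
    (N : Type*) [AddCommGroup N] (M : AddSubgroup N)
    (ℓ : ℕ) (hℓ : ℓ.Prime) (n : ℕ) (hn : 0 < n)
    (hcap : ∀ x ∈ M, (∃ y : N, (ℓ ^ n) • y = x) → x = 0)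
    (hmax : ∀ M' : AddSubgroup N, M ≤ M' →
      (∀ x ∈ M', (∃ y : N, (ℓ ^ n) • y = x) → x = 0) → M' = M) :
    ∃ P : AddSubgroup N, IsCompl M P := by
  have hl : Prime (ℓ : ℤ) := Nat.prime_iff_prime_int.1 hℓ
  have hcast : ∀ y : N, (ℓ ^ n) • y = (ℓ : ℤ) ^ n • y := fun y => by
    rw [← natCast_zsmul]; push_cast; rfl
  have hcap' : ∀ x ∈ M, ∀ y : N, x = (ℓ : ℤ) ^ n • y → x = 0 := fun x hx y h =>
    hcap x hx ⟨y, by rw [hcast, h]⟩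
  have hpure := aux_pure M (ℓ : ℤ) hl n hcap' (by
    intro z hz
    by_contra hcon
    push Not at hcon
    apply hz
    rw [← hmax (M ⊔ AddSubgroup.zmultiples z) le_sup_left ?_]
    · exact AddSubgroup.mem_sup_right (AddSubgroup.mem_zmultiples z)
    · rintro x hx ⟨y, hy⟩
      obtain ⟨m, hm, q, hq, rfl⟩ := AddSubgroup.mem_sup.1 hx
      obtain ⟨k, rfl⟩ := AddSubgroup.mem_zmultiples_iff.1 hq
      exact hcon m hm k y (by rw [← hcast, hy]))
  let S : Set (AddSubgroup N) := {P | ∀ m ∈ M, ∀ p ∈ P, ∀ (y : N) (j : ℕ),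
    m + p = (ℓ : ℤ) ^ j • y → ∃ m' ∈ M, m = (ℓ : ℤ) ^ j • m'}
  let P0 : AddSubgroup N := (zsmulAddGroupHom ((ℓ : ℤ) ^ n) : N →+ N).range
  have hP0 : P0 ∈ S := by
    rintro m hm _ ⟨z, rfl⟩ y j h
    have h' : m + (ℓ : ℤ) ^ n • z = (ℓ : ℤ) ^ j • y := h
    have h2 := eq_sub_of_add_eq h'
    rcases Nat.le_total j n with hj | hj
    · refine hpure j hj m hm (y - (ℓ : ℤ) ^ (n - j) • z) ?_
      obtain ⟨c, rfl⟩ := Nat.exists_eq_add_of_le hj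
      rw [h2, Nat.add_sub_cancel_left]; module
    · refine ⟨0, M.zero_mem, ?_⟩
      rw [smul_zero]
      refine hcap' m hm ((ℓ : ℤ) ^ (j - n) • y - z) ?_
      obtain ⟨c, rfl⟩ := Nat.exists_eq_add_of_le hj
      rw [h2, Nat.add_sub_cancel_left]; module
  obtain ⟨P, hle, hP⟩ := zorn_le_nonempty₀ S (by
    intro c hc hch Q hQ
    refine ⟨sSup c, ?_, fun z hz => le_sSup hz⟩
    intro m hm p hp
    obtain ⟨R, hR, hpR⟩ := (AddSubgroup.mem_sSup_of_directedOn ⟨Q, hQ⟩ hch.directedOn).1 hp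
    exact hc hR m hm p hpR) P0 hP0
  have hnP : ∀ y : N, (ℓ : ℤ) ^ n • y ∈ P := fun y => hle ⟨y, rfl⟩
  refine ⟨P, ?_, ?_⟩
  · rw [disjoint_iff, eq_bot_iff]
    rintro x ⟨hxM, hxP⟩
    obtain ⟨m', hm', h⟩ := hP.1 x hxM (-x) (P.neg_mem hxP) 0 n (by simp)
    exact hcap' x hxM m' h
  · rw [codisjoint_iff]
    by_contra hne
    obtain ⟨x, hx, h⟩ := aux_ext M P (ℓ : ℤ) hl n hnP hP.1 hne
    exact hx (hP.2 (y := P ⊔ AddSubgroup.zmultiples x) h le_sup_left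
      (AddSubgroup.mem_sup_right (AddSubgroup.mem_zmultiples x)))
end

section
/- Let M be an abelian group such that the quotient M/nM is finite for every integer n ≥ 1. Then the first Ulm subgroup U(M) = ⋂_{n≥1} nM coincides with the largest divisible subgroup M_div of M. -/
/-- The subgroup `nM` of an abelian group `M` (the range of multiplication by `n`). -/
def nsmulSub (M : Type*) [AddCommGroup M] (n : ℕ) : AddSubgroup M :=
  AddMonoidHom.range (n • AddMonoidHom.id M)

/-- The first Ulm subgroup `U(M) = ⋂_{n ≥ 1} nM` of an abelian group `M`. -/
def ulmSub (M : Type*) [AddCommGroup M] : AddSubgroup M :=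
  ⨅ (n : ℕ) (_ : 1 ≤ n), nsmulSub M n

/-- A subgroup `D` of an abelian group is divisible if every element of `D` is divisible
within `D` by every integer `n ≥ 1`. -/
def IsDivisibleSubgroup {M : Type*} [AddCommGroup M] (D : AddSubgroup M) : Prop :=
  ∀ n : ℕ, 1 ≤ n → ∀ x ∈ D, ∃ y ∈ D, n • y = x

theorem mem_nsmulSub' {M : Type*} [AddCommGroup M] {n : ℕ} {x : M} :
    x ∈ nsmulSub M n ↔ ∃ y, n • y = x := by
  simp [nsmulSub, AddMonoidHom.mem_range]

theorem mem_ulmSub' {M : Type*} [AddCommGroup M] {x : M} :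
    x ∈ ulmSub M ↔ ∀ n : ℕ, 1 ≤ n → ∃ y, n • y = x := by
  simp only [ulmSub, AddSubgroup.mem_iInf, mem_nsmulSub']

theorem chain_stab {M : Type*} [AddCommGroup M] (p : ℕ) (hf : Finite (M ⧸ nsmulSub M p)) :
    ∃ K : ℕ, ∀ k, K ≤ k → ∀ w : M, (∃ u, p ^ (k + 1) • u = p ^ k • w) →
      ∃ u, p ^ (K + 1) • u = p ^ K • w := by
  let B : ℕ →o Set (M ⧸ nsmulSub M p) :=
    { toFun := fun k => {q | ∃ w : M, (QuotientAddGroup.mk w : M ⧸ nsmulSub M p) = q ∧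
        ∃ u, p ^ (k + 1) • u = p ^ k • w}
      monotone' := by
        apply monotone_nat_of_le_succ
        rintro k q ⟨w, hw, u, hu⟩
        refine ⟨w, hw, u, ?_⟩
        rw [pow_succ' p (k + 1), mul_smul, hu, pow_succ' p k, mul_smul] }
  obtain ⟨K, hK⟩ := WellFoundedGT.monotone_chain_condition B
  refine ⟨K, fun k hk w hw => ?_⟩
  have h1 : (QuotientAddGroup.mk w : M ⧸ nsmulSub M p) ∈ B k := ⟨w, rfl, hw⟩
  rw [← hK k hk] at h1
  obtain ⟨w', hw', u, hu⟩ := h1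
  rw [QuotientAddGroup.eq, mem_nsmulSub'] at hw'
  obtain ⟨v, hv⟩ := hw'
  refine ⟨u + v, ?_⟩
  have : w = w' + p • v := by rw [hv]; abel
  rw [smul_add, hu, this, smul_add, pow_succ, mul_smul]

theorem tors_mem {M : Type*} [AddCommGroup M] (p : ℕ) (hp : p.Prime)
    (hf : Finite (M ⧸ nsmulSub M p)) :
    ∃ K : ℕ, ∀ w : M, p • (p ^ K • w) = 0 → p ^ K • w ∈ ulmSub M := by
  obtain ⟨K, hK⟩ := chain_stab p hf
  refine ⟨K, fun w hw => ?_⟩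
  have key : ∀ j : ℕ, ∃ v, p ^ (K + j) • v = p ^ K • w := by
    intro j
    induction j with
    | zero => exact ⟨w, rfl⟩
    | succ j ih =>
      obtain ⟨v, hv⟩ := ih
      obtain ⟨u, hu⟩ := hK (K + j + 1) (by omega) v
        ⟨0, by rw [smul_zero, pow_succ', mul_smul, hv, hw]⟩
      refine ⟨u, ?_⟩
      rw [← hv, show K + (j + 1) = j + (K + 1) by ring, pow_add, mul_smul, hu, ← mul_smul,
        ← pow_add, add_comm j K]
  rw [mem_ulmSub']
  intro m hm
  obtain ⟨e, q, hq, rfl⟩ := Nat.exists_eq_pow_mul_and_not_dvd (n := m) (by omega) p hp.ne_one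
  obtain ⟨v, hv⟩ := key e
  have hc : IsCoprime (p : ℤ) (q : ℤ) :=
    Nat.isCoprime_iff_coprime.2 ((Nat.Prime.coprime_iff_not_dvd hp).2 hq)
  obtain ⟨a, b, hab⟩ := hc
  refine ⟨b • (p ^ K • v), ?_⟩
  generalize hz : p ^ K • w = z at *
  have h2 : z = (a * p + b * q : ℤ) • z := by rw [hab, one_smul]
  rw [add_smul, mul_smul, mul_smul, natCast_zsmul, hw, smul_zero, zero_add, natCast_zsmul] at h2
  rw [h2]
  rw [← hv, pow_add]
  module

theorem prime_div {M : Type*} [AddCommGroup M] (p : ℕ) (hp : p.Prime)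
    (hf : Finite (M ⧸ nsmulSub M p)) (x : M) (hx : x ∈ ulmSub M) :
    ∃ y ∈ ulmSub M, p • y = x := by
  obtain ⟨K, hK⟩ := tors_mem p hp hf
  have hx' := mem_ulmSub'.1 hx
  have hpK : 0 < p ^ K := pow_pos hp.pos K
  obtain ⟨y, hy⟩ := hx' (p * p ^ K) (Nat.mul_pos hp.pos hpK)
  rw [mul_smul] at hy
  refine ⟨p ^ K • y, ?_, hy⟩
  rw [mem_ulmSub']
  intro m hm
  obtain ⟨t, ht⟩ := hx' (p * p ^ K * m) (Nat.mul_pos (Nat.mul_pos hp.pos hpK) hm)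
  have h := hK (y - m • t) (by
    rw [smul_sub, smul_sub, hy, ← mul_smul, ← mul_smul, ht, sub_self])
  obtain ⟨s, hs⟩ := mem_ulmSub'.1 h m hm
  refine ⟨s + p ^ K • t, ?_⟩
  rw [smul_add, hs]
  module

/-- If `M/nM` is finite for all `n ≥ 1`, then the first Ulm subgroup
`U(M) = ⋂_{n ≥ 1} nM` coincides with the largest divisible subgroup `M_div` of `M`:
it is divisible, and it contains every divisible subgroup of `M`. -/
theorem ulm_eq_largest_divisible_subgroup
    (M : Type*) [AddCommGroup M]
    (hfin : ∀ n : ℕ, 1 ≤ n → Finite (M ⧸ nsmulSub M n)) :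
    IsDivisibleSubgroup (ulmSub M) ∧
      ∀ D : AddSubgroup M, IsDivisibleSubgroup D → D ≤ ulmSub M := by
  constructor
  · intro n
    induction n using Nat.recOnMul with
    | zero => intro h; omega
    | one => intro _ x hx; exact ⟨x, hx, one_smul _ _⟩
    | prime p hp => intro h x hx; exact prime_div p hp (hfin p h) x hx
    | mul a b iha ihb =>
      intro h x hx
      have ha : 1 ≤ a := Nat.pos_of_ne_zero (by rintro rfl; simp at h)
      have hb : 1 ≤ b := Nat.pos_of_ne_zero (by rintro rfl; simp at h)
      obtain ⟨y, hy, rfl⟩ := iha ha x hx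
      obtain ⟨z, hz, rfl⟩ := ihb hb y hy
      exact ⟨z, hz, mul_smul _ _ _⟩
  · intro D hD x hx
    rw [mem_ulmSub']
    intro n hn
    obtain ⟨y, _, hy⟩ := hD n hn x hx
    exact ⟨y, hy⟩
end

section
/- Let N be a torsion-free abelian group and ℓ a prime. If N/ℓN is finite, then the ℓ-adic completion N_ℓ = lim_n N/ℓⁿN is a free finitely generated ℤ_ℓ-module. -/
theorem aux_mem (r : ℤ) {M : Type*} [AddCommGroup M] (n : ℕ) (x : M) :
    x ∈ ((Ideal.span {r}) ^ n • ⊤ : Submodule ℤ M) ↔ ∃ y : M, r ^ n • y = x := by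
  rw [Ideal.span_singleton_pow, Submodule.ideal_span_singleton_smul,
    Submodule.mem_smul_pointwise_iff_exists]
  simp

theorem aux_mem1 (r : ℤ) {M : Type*} [AddCommGroup M] (x : M) :
    x ∈ ((Ideal.span {r}) • ⊤ : Submodule ℤ M) ↔ ∃ y : M, r • y = x := by
  simpa using aux_mem r 1 x

theorem aux_basis (ℓ : ℕ) (hℓ : ℓ.Prime) (N : Type*) [AddCommGroup N]
    (hfin : Finite (N ⧸ (Ideal.span {(ℓ : ℤ)} • (⊤ : Submodule ℤ N)))) :
    ∃ (d : ℕ) (f : (Fin d → ℤ) →ₗ[ℤ] N),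
      Function.Surjective ((Submodule.mkQ (Ideal.span {(ℓ : ℤ)} • ⊤ : Submodule ℤ N)) ∘ₗ f) ∧
      ∀ x y, f x = (ℓ : ℤ) • y → ∃ x', x = (ℓ : ℤ) • x' := by
  have hmax : (Ideal.span {(ℓ : ℤ)}).IsMaximal :=
    PrincipalIdealRing.isMaximal_of_irreducible (Nat.prime_iff_prime_int.mp hℓ).irreducible
  letI := Ideal.Quotient.field (Ideal.span {(ℓ : ℤ)})
  let b := Module.finBasis (ℤ ⧸ Ideal.span {(ℓ : ℤ)})
    (N ⧸ (Ideal.span {(ℓ : ℤ)} • (⊤ : Submodule ℤ N)))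
  choose v hv using fun i => Submodule.mkQ_surjective _ (b i)
  have key : ∀ x : Fin _ → ℤ, (Submodule.mkQ (Ideal.span {(ℓ : ℤ)} • ⊤ : Submodule ℤ N))
      (Fintype.linearCombination ℤ v x) =
      ∑ i, (Ideal.Quotient.mk (Ideal.span {(ℓ : ℤ)}) (x i)) • b i := by
    intro x
    rw [Fintype.linearCombination_apply, map_sum]
    refine Finset.sum_congr rfl fun i _ => ?_
    rw [map_smul, hv]
    rfl
  refine ⟨_, Fintype.linearCombination ℤ v, ?_, ?_⟩
  · intro q
    choose x hx using fun i => Ideal.Quotient.mk_surjective (b.repr q i)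
    refine ⟨x, ?_⟩
    rw [LinearMap.comp_apply, key]
    simp only [hx]
    exact b.sum_repr q
  · intro x y h
    have h0 := key x
    rw [h, (Submodule.Quotient.mk_eq_zero _).mpr ((aux_mem1 _ _).mpr ⟨y, rfl⟩) |>
      fun t => (Submodule.mkQ_apply _ _).trans t] at h0
    have h1 := Fintype.linearIndependent_iff.mp b.linearIndependent _ h0.symm
    have h2 : ∀ i, ∃ z, x i = (ℓ : ℤ) * z := fun i =>
      Ideal.mem_span_singleton.mp (Ideal.Quotient.eq_zero_iff_mem.mp (h1 i))
    choose z hz using h2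
    exact ⟨z, funext fun i => by simp [hz]⟩

theorem adicCompletion_free_and_finite_of_torsionFree
    (ℓ : ℕ) (hℓ : ℓ.Prime) (N : Type*) [AddCommGroup N]
    (htf : ∀ (n : ℤ) (x : N), n ≠ 0 → n • x = 0 → x = 0)
    (hfin : Finite (N ⧸ (Ideal.span {(ℓ : ℤ)} • (⊤ : Submodule ℤ N)))) :
    Module.Free (AdicCompletion (Ideal.span {(ℓ : ℤ)}) ℤ)
        (AdicCompletion (Ideal.span {(ℓ : ℤ)}) N) ∧
      Module.Finite (AdicCompletion (Ideal.span {(ℓ : ℤ)}) ℤ)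
        (AdicCompletion (Ideal.span {(ℓ : ℤ)}) N) := by
  obtain ⟨d, f, hs, hi⟩ := aux_basis ℓ hℓ N hfin
  have hl : (ℓ : ℤ) ≠ 0 := by exact_mod_cast hℓ.ne_zero
  have hn : ∀ (n : ℕ) x y, f x = (ℓ : ℤ) ^ n • y → ∃ x', (ℓ : ℤ) ^ n • x' = x := by
    intro n
    induction n with
    | zero => intro x y _; exact ⟨x, by simp⟩
    | succ n ih =>
      intro x y h
      obtain ⟨x', rfl⟩ := hi x ((ℓ : ℤ) ^ n • y) (by rw [h, smul_smul, pow_succ'])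
      obtain ⟨x'', rfl⟩ := ih x' y (by
        rw [← sub_eq_zero]
        apply htf (ℓ : ℤ) _ hl
        rw [smul_sub, ← map_smul, h, smul_smul, pow_succ', sub_self])
      exact ⟨x'', by rw [smul_smul, pow_succ']⟩
  have hinj : Function.Injective (AdicCompletion.map (Ideal.span {(ℓ : ℤ)}) f) := by
    rw [injective_iff_map_eq_zero]
    intro a ha
    ext n
    have h1 : (AdicCompletion.map (Ideal.span {(ℓ : ℤ)}) f a).val n = 0 := by rw [ha]; rfl
    rw [AdicCompletion.map_val_apply] at h1
    obtain ⟨x, hx⟩ := Submodule.Quotient.mk_surjective _ (a.val n)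
    rw [← hx] at h1 ⊢
    rw [LinearMap.reduceModIdeal_apply, Submodule.Quotient.mk_eq_zero, aux_mem] at h1
    obtain ⟨y, hy⟩ := h1
    exact (Submodule.Quotient.mk_eq_zero _).mpr ((aux_mem _ _ _).mpr (hn n x y hy.symm))
  let e := (AdicCompletion.piEquivFin (Ideal.span {(ℓ : ℤ)}) d).symm.trans
    (LinearEquiv.ofBijective _ ⟨hinj, AdicCompletion.map_surjective_of_mkQ_comp_surjective hs⟩)
  exact ⟨Module.Free.of_equiv e, Module.Finite.equiv e⟩
end

section
/- Let φ : M × N → ℤ be a bi-additive pairing of abelian groups, let ℓ be a prime, and let φ_ℓ : M_ℓ × N_ℓ → ℤ_ℓ be the induced ℤ_ℓ-bilinear pairing on ℓ-adic completions (obtained as the inverse limit of the pairings M/ℓⁿM × N/ℓⁿN → ℤ/ℓⁿℤ induced by φ). Assume that φ_ℓ has trivial left kernel (i.e., if x ∈ M_ℓ satisfies φ_ℓ(x,y) = 0 for all y ∈ N_ℓ, then x = 0), that N/ℓN is finite, and that ⋂_{n≥1} ℓⁿM = 0. Then M is a free abelian group of finite rank. -/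
/-- Let `φ : M × N → ℤ` be a bi-additive pairing of abelian groups
and `ℓ` a prime.  Elements of the `ℓ`-adic completion `M_ℓ = lim M/ℓⁿM` are represented
by coherent sequences `x : ℕ → M` with `x (n+1) ≡ x n (mod ℓⁿ M)`; such a sequence
represents `0` exactly when `x n ∈ ℓⁿ M` for all `n`, and the induced pairing
`φ_ℓ : M_ℓ × N_ℓ → ℤ_ℓ` vanishes on the pair represented by `x` and `y` exactly when
`ℓⁿ ∣ φ (x n) (y n)` for all `n`.  Assume `φ_ℓ` has trivial left kernel (hypothesis
`hker`), that `N/ℓN` is finite, and that `⋂ₙ ℓⁿ M = 0`.  Then `M` is a free abelian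
group of finite rank. -/
theorem free_of_pairing_with_trivial_left_kernel
    (ℓ : ℕ) (hℓ : ℓ.Prime)
    (M N : Type*) [AddCommGroup M] [AddCommGroup N]
    (φ : M →+ N →+ ℤ)
    (hker : ∀ x : ℕ → M, (∀ n : ℕ, ∃ m : M, x (n + 1) - x n = (ℓ ^ n) • m) →
      (∀ y : ℕ → N, (∀ n : ℕ, ∃ m : N, y (n + 1) - y n = (ℓ ^ n) • m) →
        ∀ n : ℕ, ((ℓ : ℤ) ^ n) ∣ φ (x n) (y n)) →
      ∀ n : ℕ, ∃ m : M, x n = (ℓ ^ n) • m)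
    (hNfin : Finite (N ⧸ AddMonoidHom.range (ℓ • AddMonoidHom.id N)))
    (hMcapM : ∀ x : M, (∀ n : ℕ, ∃ m : M, x = (ℓ ^ n) • m) → x = 0) :
    ∃ k : ℕ, Nonempty (M ≃+ (Fin k → ℤ)) := by
  have := Fintype.ofFinite (N ⧸ AddMonoidHom.range (ℓ • AddMonoidHom.id N))
  let f : M →+ ((N ⧸ AddMonoidHom.range (ℓ • AddMonoidHom.id N)) → ℤ) :=
    { toFun := fun x q => φ x q.out
      map_zero' := by ext q; simp
      map_add' := by intro a b; ext q; simp }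
  have hf : Function.Injective f.toIntLinearMap := by
    rw [injective_iff_map_eq_zero]
    intro x hx
    have hx0 : ∀ q : N ⧸ AddMonoidHom.range (ℓ • AddMonoidHom.id N), φ x q.out = 0 :=
      fun q => congrFun hx q
    have hdvd : ∀ n : ℕ, ∀ y : N, ((ℓ : ℤ) ^ n) ∣ φ x y := by
      intro n
      induction n with
      | zero => intro y; simp
      | succ n ih =>
        intro y
        have h1 : ((QuotientAddGroup.mk y :
            N ⧸ AddMonoidHom.range (ℓ • AddMonoidHom.id N)).out : N ⧸ _) =
            QuotientAddGroup.mk y := QuotientAddGroup.out_eq' _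
        rw [QuotientAddGroup.eq] at h1
        obtain ⟨m, hm⟩ := h1
        have h2 : φ x y = (ℓ : ℤ) * φ x m := by
          have h3 := congrArg (φ x) hm
          simp only [AddMonoidHom.smul_apply, AddMonoidHom.id_apply, map_nsmul, map_add,
            map_neg, hx0, nsmul_eq_mul] at h3
          simpa using h3.symm
        rw [h2, pow_succ']
        exact mul_dvd_mul_left _ (ih m)
    exact hMcapM x (hker (fun _ => x) (fun n => ⟨0, by simp⟩) (fun y _ n => hdvd n (y n)))
  have e := LinearEquiv.ofInjective f.toIntLinearMap hf
  have : Module.Finite ℤ M := Module.Finite.equiv e.symm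
  have : Module.Free ℤ M := Module.Free.of_equiv e.symm
  exact ⟨_, ⟨(Module.finBasis ℤ M).equivFun.toAddEquiv⟩⟩
end

section
/- Let M be an abelian group such that the quotient M/nM is finite for every integer n ≥ 1. Then the quotient M/U(M) of M by its first Ulm subgroup has trivial first Ulm subgroup: U(M/U(M)) = 0. -/
theorem mem_ulmSub_iff (M : Type*) [AddCommGroup M] (x : M) :
    x ∈ ulmSub M ↔ ∀ n : ℕ, 1 ≤ n → x ∈ nsmulSub M n := by
  simp only [ulmSub, AddSubgroup.mem_iInf]

/-- If `M/nM` is finite for every `n ≥ 1`, then the quotient of `M` by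
its first Ulm subgroup has trivial first Ulm subgroup: `U(M/U(M)) = 0`. -/
theorem ulm_of_quotient_by_ulm_eq_bot
    (M : Type*) [AddCommGroup M]
    (hfin : ∀ n : ℕ, 1 ≤ n → Finite (M ⧸ nsmulSub M n)) :
    ulmSub (M ⧸ ulmSub M) = ⊥ := by
  rw [eq_bot_iff]
  intro x hx
  obtain ⟨m, rfl⟩ := QuotientAddGroup.mk_surjective x
  rw [AddSubgroup.mem_bot, QuotientAddGroup.eq_zero_iff]
  rw [mem_ulmSub_iff] at hx ⊢
  intro n hn
  obtain ⟨y, hy⟩ := hx n hn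
  obtain ⟨y, rfl⟩ := QuotientAddGroup.mk_surjective y
  have h1 : ((n • y : M) : M ⧸ ulmSub M) = (m : M ⧸ ulmSub M) := hy
  have h2 : -(n • y) + m ∈ ulmSub M := QuotientAddGroup.eq.1 h1
  rw [mem_ulmSub_iff] at h2
  have h3 := h2 n hn
  have h4 : n • y ∈ nsmulSub M n := ⟨y, rfl⟩
  have h5 := add_mem h4 h3
  rwa [add_neg_cancel_left] at h5
end

section
/- Fix a prime p and let ℤ^p = ∏_{ℓ ≠ p} ℤ_ℓ, the product of the rings of ℓ-adic integers over all primes ℓ different from p. For a ℤ^p-module M the following conditions are equivalent: (a) M is a finitely presented ℤ^p-module; (b) for every prime ℓ ≠ p the ℤ_ℓ-module ℤ_ℓ ⊗_{ℤ^p} M is finitely generated, the natural map M → ∏_{ℓ ≠ p} (ℤ_ℓ ⊗_{ℤ^p} M) is an isomorphism, and the dimensions dim_{𝔽_ℓ}(M/ℓM) are bounded independently of ℓ; (c) the natural map M → lim_{(m,p)=1} M/mM (inverse limit over positive integers m prime to p, ordered by divisibility) is an isomorphism, and the dimensions dim_{𝔽_ℓ}(M/ℓM) are bounded independently of ℓ.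 -/
open scoped TensorProduct

/-- The set of primes different from `p`. -/
abbrev PrimesNe (p : ℕ) : Type := {l : ℕ // l.Prime ∧ l ≠ p}

/-- The ring `ℤ_ℓ` of `ℓ`-adic integers, for `ℓ` a prime different from `p`. -/
abbrev Zl (p : ℕ) (l : PrimesNe p) : Type := @PadicInt l.1 ⟨l.2.1⟩

/-- The ring `ℤ^p = ∏_{ℓ ≠ p} ℤ_ℓ`. -/
abbrev Zhat (p : ℕ) : Type := ∀ l : PrimesNe p, Zl p l

noncomputable instance (p : ℕ) (l : PrimesNe p) : Algebra (Zhat p) (Zl p l) :=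
  (Pi.evalRingHom (Zl p) l).toAlgebra


namespace ZhatAux
variable {p : ℕ}

theorem factPrime (l : PrimesNe p) : Fact l.1.Prime := ⟨l.2.1⟩
attribute [local instance] factPrime

open Classical in
noncomputable def E (l : PrimesNe p) (a : Zl p l) : Zhat p := Pi.single l a

theorem E_same (l : PrimesNe p) (a : Zl p l) : E l a l = a := by simp [E]
theorem E_ne {l l' : PrimesNe p} (h : l' ≠ l) (a : Zl p l) : E l a l' = 0 := by
  simp [E, h]

theorem E_mul_z (l : PrimesNe p) (a : Zl p l) (z : Zhat p) : E l a * z = E l (a * z l) := by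
  funext l'
  by_cases h : l' = l
  · subst h; simp [E_same]
  · simp [E_ne h]

theorem E_mul (l : PrimesNe p) (a b : Zl p l) : E l a * E l b = E l (a * b) := by
  rw [E_mul_z, E_same]

theorem E_mul_ne {l l' : PrimesNe p} (h : l ≠ l') (a : Zl p l) (b : Zl p l') :
    E l a * E l' b = 0 := by
  rw [E_mul_z, E_ne h]; simp [E]

theorem E_zero (l : PrimesNe p) : E l 0 = 0 := by simp [E]
theorem E_add (l : PrimesNe p) (a b : Zl p l) : E l (a + b) = E l a + E l b := by
  simp [E, Pi.single_add]
theorem E_sub (l : PrimesNe p) (a b : Zl p l) : E l (a - b) = E l a - E l b := by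
  simp [E, Pi.single_sub]
theorem E_nat (l : PrimesNe p) (n : ℕ) (a : Zl p l) : E l (n * a) = n * E l a := by
  rw [mul_comm, mul_comm (n : Zhat p), E_mul_z]; simp

variable {M : Type*} [AddCommGroup M] [Module (Zhat p) M]

theorem z_smul (l : PrimesNe p) (a : Zl p l) (z : Zhat p) (x : M) :
    E l a • z • x = E l (a * z l) • x := by rw [smul_smul, E_mul_z]
theorem ee (l : PrimesNe p) (a b : Zl p l) (x : M) :
    E l a • E l b • x = E l (a * b) • x := by rw [smul_smul, E_mul]
theorem ee_ne {l l' : PrimesNe p} (h : l ≠ l') (a : Zl p l) (b : Zl p l') (x : M) :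
    E l a • E l' b • x = 0 := by rw [smul_smul, E_mul_ne h, zero_smul]
theorem ne_smul (l : PrimesNe p) (n : ℕ) (a : Zl p l) (x : M) :
    n • E l a • x = E l (n * a) • x := by
  rw [E_nat, mul_smul, Nat.cast_smul_eq_nsmul]
theorem en_smul (l : PrimesNe p) (n : ℕ) (a : Zl p l) (x : M) :
    E l a • n • x = E l (n * a) • x := by
  rw [smul_comm, ne_smul]

variable (M) in
/-- assembling -/
def Surj (p : ℕ) [Module (Zhat p) M] : Prop :=
  ∀ y : PrimesNe p → M, ∃ x : M, ∀ l, E l 1 • x = E l 1 • y l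
variable (M) in
def Inj (p : ℕ) [Module (Zhat p) M] : Prop :=
  ∀ x : M, (∀ l : PrimesNe p, E l 1 • x = 0) → x = 0
variable (M) in
def Sep (p : ℕ) [Module (Zhat p) M] (l : PrimesNe p) : Prop :=
  ∀ y : M, (∀ n : ℕ, ∃ z : M, E l 1 • y = (l.1 ^ n) • z) → E l 1 • y = 0

/-- limits -/
theorem exists_lim (l : PrimesNe p) (w : ℕ → Zl p l) :
    ∃ v : Zl p l, ∀ N, ∃ b, v = ∑ k ∈ Finset.range N, (l.1 : Zl p l) ^ k * w k + (l.1 : Zl p l) ^ N * b := by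
  have H := (inferInstance : IsAdicComplete (IsLocalRing.maximalIdeal (Zl p l)) (Zl p l)).toIsPrecomplete.prec'
    (fun N => ∑ k ∈ Finset.range N, (l.1 : Zl p l) ^ k * w k) ?_
  · obtain ⟨L, hL⟩ := H
    refine ⟨L, fun N => ?_⟩
    have := (hL N).symm
    rw [SModEq.sub_mem, PadicInt.maximalIdeal_eq_span_p, Ideal.span_singleton_pow, smul_eq_mul,
      Ideal.mul_top, Ideal.mem_span_singleton] at this
    obtain ⟨b, hb⟩ := this
    exact ⟨b, by rw [← hb]; ring⟩
  · intro m n hmn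
    apply SModEq.symm
    rw [SModEq.sub_mem, PadicInt.maximalIdeal_eq_span_p, Ideal.span_singleton_pow, smul_eq_mul,
      Ideal.mul_top, Ideal.mem_span_singleton, ← Finset.sum_Ico_eq_sub _ hmn]
    apply Finset.dvd_sum
    intro k hk
    exact Dvd.dvd.mul_right (pow_dvd_pow _ (Finset.mem_Ico.1 hk).1) _

theorem exists_unit (l : PrimesNe p) (m : ℕ) (hm : 0 < m) :
    ∃ u : Zl p l, (m : Zl p l) * u = ((l.1 ^ (m.factorization l.1) : ℕ) : Zl p l) := by
  have h1 : IsUnit ((m / l.1 ^ (m.factorization l.1) : ℕ) : Zl p l) := by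
    have h2 := Nat.coprime_ordCompl l.2.1 hm.ne'
    rw [PadicInt.isUnit_iff]
    by_contra h
    have h3 : ‖((m / l.1 ^ (m.factorization l.1) : ℕ) : Zl p l)‖ < 1 :=
      lt_of_le_of_ne (PadicInt.norm_le_one _) h
    have h4 : l.1 ∣ m / l.1 ^ (m.factorization l.1) := by simpa using h3
    exact (Nat.Prime.coprime_iff_not_dvd l.2.1).1 h2 h4
  obtain ⟨u, hu⟩ := h1.exists_right_inv
  refine ⟨u, ?_⟩
  conv_lhs => rw [← Nat.ordProj_mul_ordCompl_eq_self m l.1]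
  rw [Nat.cast_mul, mul_assoc, hu, mul_one]

theorem mem_of_pow (l : PrimesNe p) (m : ℕ) (hm : 0 < m) (y z : M)
    (h : E l 1 • y = (l.1 ^ (m.factorization l.1)) • z) : ∃ w, E l 1 • y = m • E l 1 • w := by
  obtain ⟨u, hu⟩ := exists_unit l m hm
  refine ⟨E l u • z, ?_⟩
  have : E l 1 • E l 1 • y = E l 1 • (l.1 ^ (m.factorization l.1)) • z := by rw [h]
  rw [ee, en_smul, one_mul] at this
  rw [this, ee, ne_smul, ← hu]; congr 2; ring

/-- Nakayama -/
theorem nakayama (l : PrimesNe p) (hS : Sep M p l) {C : ℕ} (X : Fin C → M)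
    (h : ∀ y : M, ∃ (c : Fin C → Zl p l) (z : M), E l 1 • y = ∑ i, E l (c i) • X i + l.1 • z) (y : M) :
    ∃ a : Fin C → Zl p l, E l 1 • y = ∑ i, E l (a i) • X i := by
  choose c z hcz using h
  let Y : ℕ → M := fun n => z^[n] y
  have hY : ∀ n, Y (n+1) = z (Y n) := fun n => Function.iterate_succ_apply' z n y
  have key : ∀ N, E l 1 • y = ∑ i, E l (∑ k ∈ Finset.range N, (l.1 : Zl p l) ^ k * c (Y k) i) • X i
      + l.1 ^ N • E l 1 • Y N := by
    intro N
    induction N with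
    | zero => simp [E_zero, Y]
    | succ N ih =>
      rw [ih]
      have h2 : E l 1 • Y N = ∑ i, E l (c (Y N) i) • X i + l.1 • E l 1 • Y (N+1) := by
        have : E l 1 • E l 1 • Y N = E l 1 • (∑ i, E l (c (Y N) i) • X i + l.1 • z (Y N)) := by
          rw [← hcz]
        rw [ee, smul_add, Finset.smul_sum] at this
        simp only [ee, one_mul] at this
        rw [this, hY, smul_comm]
      rw [h2, smul_add, ← add_assoc, Finset.smul_sum, ← Finset.sum_add_distrib, smul_smul, pow_succ]
      congr 1
      apply Finset.sum_congr rfl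
      intro i _
      rw [ne_smul, ← add_smul, ← E_add, Finset.sum_range_succ]
      push_cast; rfl
  choose a ha using fun i => exists_lim l (fun k => c (Y k) i)
  refine ⟨a, ?_⟩
  have h0 : E l 1 • (y - ∑ i, E l (a i) • X i) = 0 := by
    apply hS
    intro N
    choose b hb using fun i => ha i N
    refine ⟨E l 1 • Y N - ∑ i, E l (b i) • X i, ?_⟩
    rw [smul_sub, key N, Finset.smul_sum, smul_sub, Finset.smul_sum]
    have : ∀ i, E l 1 • E l (a i) • X i = E l (∑ k ∈ Finset.range N, (l.1 : Zl p l) ^ k * c (Y k) i) • X i + (l.1 ^ N) • E l (b i) • X i := by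
      intro i
      rw [ee, one_mul, hb i, E_add, add_smul, ne_smul]
      push_cast; rfl
    rw [Finset.sum_congr rfl (fun i _ => this i), Finset.sum_add_distrib]
    abel
  rw [smul_sub, Finset.smul_sum, sub_eq_zero] at h0
  simpa only [ee, one_mul] using h0

theorem span_extend {R V : Type*} [Semiring R] [AddCommMonoid V] [Module R V] {d C : ℕ} (h : d ≤ C)
    (v : Fin d → V) : ∃ w : Fin C → V, Submodule.span R (Set.range w) = Submodule.span R (Set.range v) := by
  refine ⟨fun i => if hi : i.1 < d then v ⟨i.1, hi⟩ else 0, le_antisymm ?_ ?_⟩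
  · rw [Submodule.span_le]
    rintro _ ⟨i, rfl⟩
    dsimp only
    split_ifs with hi
    · exact Submodule.subset_span ⟨_, rfl⟩
    · exact Submodule.zero_mem _
  · rw [Submodule.span_le]
    rintro _ ⟨i, rfl⟩
    exact Submodule.subset_span ⟨⟨i.1, i.2.trans_le h⟩, by simp⟩

theorem exists_span (l C : ℕ) [Fact l.Prime] (V : Type*) [AddCommGroup V] [Module (ZMod l) V] [Finite V]
    (hc : Nat.card V ≤ l ^ C) : ∃ w : Fin C → V, ∀ v, ∃ c : Fin C → ℕ, ∑ i, c i • w i = v := by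
  have : Module.Finite (ZMod l) V := Module.Finite.of_finite
  have hd : Module.finrank (ZMod l) V ≤ C := by
    have := Module.natCard_eq_pow_finrank (K := ZMod l) (V := V)
    rw [this, Nat.card_zmod] at hc
    exact (Nat.pow_le_pow_iff_right (Fact.out : l.Prime).one_lt).1 hc
  obtain ⟨w, hw⟩ := span_extend (R := ZMod l) hd (Module.finBasis (ZMod l) V)
  rw [Module.Basis.span_eq] at hw
  refine ⟨w, fun v => ?_⟩
  obtain ⟨c, hc⟩ := (Submodule.mem_span_range_iff_exists_fun (ZMod l)).1 (hw ▸ Submodule.mem_top : v ∈ _)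
  refine ⟨fun i => (c i).val, ?_⟩
  rw [← hc]
  refine Finset.sum_congr rfl fun i _ => ?_
  rw [← Nat.cast_smul_eq_nsmul (ZMod l), ZMod.natCast_zmod_val]

theorem exists_gens {G : Type*} [AddCommGroup G] (l C : ℕ) (hl : l.Prime)
    (hf : Finite (G ⧸ AddMonoidHom.range (l • AddMonoidHom.id G)))
    (hc : Nat.card (G ⧸ AddMonoidHom.range (l • AddMonoidHom.id G)) ≤ l ^ C) :
    ∃ X : Fin C → G, ∀ y : G, ∃ (c : Fin C → ℕ) (z : G), y = ∑ i, c i • X i + l • z := by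
  have : Fact l.Prime := ⟨hl⟩
  let _ : Module (ZMod l) (G ⧸ AddMonoidHom.range (l • AddMonoidHom.id G)) :=
    QuotientAddGroup.zmodModule (fun x => ⟨x, rfl⟩)
  obtain ⟨w, hw⟩ := exists_span l C _ hc
  choose X hX using fun i => QuotientAddGroup.mk_surjective (w i)
  refine ⟨X, fun y => ?_⟩
  obtain ⟨c, hc⟩ := hw (QuotientAddGroup.mk y)
  have h1 : (QuotientAddGroup.mk (∑ i, c i • X i) : G ⧸ AddMonoidHom.range (l • AddMonoidHom.id G)) = QuotientAddGroup.mk y := by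
    rw [← hc]
    rw [← QuotientAddGroup.mk'_apply, map_sum]
    apply Finset.sum_congr rfl
    intro i _
    rw [map_nsmul, QuotientAddGroup.mk'_apply, hX]
  rw [QuotientAddGroup.eq] at h1
  obtain ⟨z, hz⟩ := h1
  refine ⟨fun i => c i, z, ?_⟩
  have : l • z = -(∑ i, c i • X i) + y := hz
  rw [this]; abel

theorem fp_of (hI : Inj M p) (hS : Surj M p) (hSep : ∀ l, Sep M p l) (C : ℕ)
    (hC : ∀ l : PrimesNe p,
      Finite (M ⧸ AddMonoidHom.range ((l.1 : ℕ) • AddMonoidHom.id M)) ∧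
      Nat.card (M ⧸ AddMonoidHom.range ((l.1 : ℕ) • AddMonoidHom.id M)) ≤ l.1 ^ C) :
    Module.FinitePresentation (Zhat p) M := by
  choose X0 hX0 using fun l : PrimesNe p => exists_gens (G := M) l.1 C l.2.1 (hC l).1 (hC l).2
  choose X hX using fun i => hS (fun l => X0 l i)
  have hXE : ∀ (l : PrimesNe p) i (a : Zl p l), E l a • X i = E l a • X0 l i := by
    intro l i a
    have := congrArg (fun x => E l a • x) (hX i l)
    simpa only [ee, mul_one] using this
  have hgen : ∀ (l : PrimesNe p) (y : M), ∃ a : Fin C → Zl p l, E l 1 • y = ∑ i, E l (a i) • X i := by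
    intro l
    apply nakayama l (hSep l)
    intro y
    obtain ⟨c, z, h⟩ := hX0 l y
    refine ⟨fun i => c i, E l 1 • z, ?_⟩
    conv_lhs => rw [h]
    rw [smul_add, Finset.smul_sum, smul_comm]
    congr 1
    refine Finset.sum_congr rfl fun i _ => ?_
    rw [en_smul, hXE, mul_one]
  let φ : (Fin C → Zhat p) →ₗ[Zhat p] M := Fintype.linearCombination (Zhat p) X
  have hφ : ∀ v, φ v = ∑ i, v i • X i := fun v => rfl
  have hφE : ∀ l v, E l 1 • φ v = ∑ i, E l (v i l) • X i := by
    intro l v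
    rw [hφ, Finset.smul_sum]
    simp only [z_smul, one_mul]
  have hsurj : Function.Surjective φ := by
    intro y
    choose a ha using fun l => hgen l y
    refine ⟨fun i l => a l i, ?_⟩
    rw [← sub_eq_zero]
    apply hI
    intro l
    rw [smul_sub, hφE, ha, sub_self]
  refine Module.finitePresentation_of_surjective φ hsurj ?_
  have hK : ∀ l : PrimesNe p, ∃ k : Fin C → (Fin C → Zl p l),
      (∀ j, ∑ i, E l (k j i) • X i = 0) ∧
      ∀ v : Fin C → Zl p l, ∑ i, E l (v i) • X i = 0 → ∃ c : Fin C → Zl p l, v = ∑ j, c j • k j := by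
    intro l
    let K : Submodule (Zl p l) (Fin C → Zl p l) :=
      { carrier := {v | ∑ i, E l (v i) • X i = 0}
        add_mem' := by
          intro a b ha hb
          simp only [Set.mem_ofPred_eq, Pi.add_apply, E_add, add_smul, Finset.sum_add_distrib] at *
          rw [ha, hb, add_zero]
        zero_mem' := by simp [E_zero]
        smul_mem' := by
          intro c a ha
          simp only [Set.mem_ofPred_eq] at *
          have : E l c • ∑ i, E l (a i) • X i = 0 := by rw [ha, smul_zero]
          rw [Finset.smul_sum] at this
          simp only [ee] at this
          exact this }
    obtain ⟨n, ⟨b⟩⟩ := K.nonempty_basis_of_pid (Pi.basisFun (Zl p l) (Fin C))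
    have hn : n ≤ C := by
      have h1 := Submodule.finrank_le K
      rw [Module.finrank_eq_card_basis b] at h1
      simpa using h1
    obtain ⟨k, hk⟩ := span_extend (R := Zl p l) hn (fun i => (b i : Fin C → Zl p l))
    have hk2 : Submodule.span (Zl p l) (Set.range k) = K := by
      rw [hk]
      have h3 := congrArg (Submodule.map K.subtype) b.span_eq
      rw [Submodule.map_span, Submodule.map_top, Submodule.range_subtype, ← Set.range_comp] at h3
      exact h3
    refine ⟨k, fun j => ?_, fun v hv => ?_⟩
    · have : k j ∈ K := hk2 ▸ Submodule.subset_span ⟨j, rfl⟩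
      exact this
    · have : v ∈ K := hv
      rw [← hk2, Submodule.mem_span_range_iff_exists_fun] at this
      obtain ⟨c, hc⟩ := this
      exact ⟨c, hc.symm⟩
  choose k hk0 hk1 using hK
  let kk : Fin C → (Fin C → Zhat p) := fun j i l => k l j i
  have : LinearMap.ker φ = Submodule.span (Zhat p) (Set.range kk) := by
    apply le_antisymm
    · intro v hv
      have hv0 : φ v = 0 := hv
      choose c hc using fun l => hk1 l (fun i => v i l) (by rw [← hφE, hv0, smul_zero])
      rw [Submodule.mem_span_range_iff_exists_fun]
      refine ⟨fun j l => c l j, ?_⟩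
      funext i l
      have := congrFun (hc l) i
      simp only [Finset.sum_apply, Pi.smul_apply, smul_eq_mul, Pi.mul_apply] at this ⊢
      exact this.symm
    · rw [Submodule.span_le]
      rintro _ ⟨j, rfl⟩
      apply hI
      intro l
      rw [hφE]
      exact hk0 l j
  rw [this]
  exact Submodule.fg_span (Set.finite_range _)

/-- the linear map -/
noncomputable def Elin (l : PrimesNe p) : Zl p l →ₗ[Zhat p] Zhat p where
  toFun := E l
  map_add' := E_add l
  map_smul' := by
    intro z a
    change E l (z l * a) = z * E l a
    rw [mul_comm z, E_mul_z, mul_comm]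

theorem one_tmul_smul (l : PrimesNe p) (z : Zhat p) (x : M) :
    (z l) ⊗ₜ[Zhat p] x = (1 : Zl p l) ⊗ₜ[Zhat p] (z • x) := by
  rw [← TensorProduct.smul_tmul]
  congr 1
  change z l = z l * 1
  rw [mul_one]

theorem tens_eq (l : PrimesNe p) (x y : M) :
    (1 : Zl p l) ⊗ₜ[Zhat p] x = (1 : Zl p l) ⊗ₜ[Zhat p] y ↔ E l 1 • x = E l 1 • y := by
  constructor
  · intro h
    have := congrArg (TensorProduct.lift ((LinearMap.lsmul (Zhat p) M).comp (Elin l))) h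
    simpa [Elin] using this
  · intro h
    have h1 := one_tmul_smul l (E l 1) x
    have h2 := one_tmul_smul l (E l 1) y
    rw [E_same] at h1 h2
    rw [h1, h2, h]

theorem tens_surj (l : PrimesNe p) (t : (Zl p l) ⊗[Zhat p] M) :
    ∃ x : M, (1 : Zl p l) ⊗ₜ[Zhat p] x = t := by
  induction t with
  | zero => exact ⟨0, TensorProduct.tmul_zero _ _⟩
  | tmul a x => exact ⟨E l a • x, by rw [← one_tmul_smul, E_same]⟩
  | add s t hs ht =>
    obtain ⟨x, hx⟩ := hs
    obtain ⟨y, hy⟩ := ht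
    exact ⟨x + y, by rw [TensorProduct.tmul_add, hx, hy]⟩

theorem bij_iff : Function.Bijective
          (fun (x : M) (l : PrimesNe p) => (1 : Zl p l) ⊗ₜ[Zhat p] x) ↔ Inj M p ∧ Surj M p := by
  refine and_congr ⟨fun h x hx => ?_, fun h x y hxy => ?_⟩ ⟨fun h y => ?_, fun h t => ?_⟩
  · apply h
    funext l
    rw [tens_eq, hx, smul_zero]
  · rw [← sub_eq_zero]
    apply h
    intro l
    rw [smul_sub, sub_eq_zero, ← tens_eq]
    exact congrFun hxy l
  · obtain ⟨x, hx⟩ := h (fun l => (1 : Zl p l) ⊗ₜ[Zhat p] y l)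
    exact ⟨x, fun l => (tens_eq l _ _).1 (congrFun hx l)⟩
  · choose y hy using fun l => tens_surj l (t l)
    obtain ⟨x, hx⟩ := h y
    refine ⟨x, ?_⟩
    funext l
    rw [← hy l]
    exact (tens_eq l _ _).2 (hx l)

theorem sep_of_finite (l : PrimesNe p) (h : Module.Finite (Zl p l) ((Zl p l) ⊗[Zhat p] M)) :
    Sep M p l := by
  intro y hy
  have H : IsHausdorff (IsLocalRing.maximalIdeal (Zl p l)) ((Zl p l) ⊗[Zhat p] M) := inferInstance
  have h0 : (1 : Zl p l) ⊗ₜ[Zhat p] (E l 1 • y) = 0 := by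
    apply H.haus
    intro n
    obtain ⟨z, hz⟩ := hy n
    rw [SModEq.zero, hz, PadicInt.maximalIdeal_eq_span_p, Ideal.span_singleton_pow]
    have : (1 : Zl p l) ⊗ₜ[Zhat p] (l.1 ^ n • z) = ((l.1 : Zl p l) ^ n) • ((1 : Zl p l) ⊗ₜ[Zhat p] z) := by
      rw [TensorProduct.tmul_smul, ← Nat.cast_pow, Nat.cast_smul_eq_nsmul]
    rw [this]
    exact Submodule.smul_mem_smul (Ideal.mem_span_singleton_self _) trivial
  rw [← TensorProduct.tmul_zero M (1 : Zl p l), tens_eq, ee, smul_zero, one_mul] at h0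
  exact h0

theorem inj_surj_of_fp (h : Module.FinitePresentation (Zhat p) M) : Inj M p ∧ Surj M p := by
  obtain ⟨n, m, f, g, hf, hfg⟩ := Module.FinitePresentation.exists_fin' (Zhat p) M
  constructor
  · intro x hx
    obtain ⟨v, rfl⟩ := hf x
    have : ∀ l : PrimesNe p, ∃ w, g w = E l 1 • v := fun l => (hfg _).1 (by rw [map_smul, hx])
    choose w hw using this
    apply (hfg _).2
    refine ⟨fun j l => w l j l, ?_⟩
    have key : ∀ (l : PrimesNe p) (w w' : Fin m → Zhat p), (∀ j, w j l = w' j l) → ∀ i, g w i l = g w' i l := by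
      intro l w w' h i
      have h1 : E l 1 • w = E l 1 • w' := by
        funext j
        simp only [Pi.smul_apply, smul_eq_mul]
        rw [E_mul_z, E_mul_z, h]
      have h2 := congrArg g h1
      rw [map_smul, map_smul] at h2
      have h3 := congrFun (congrFun h2 i) l
      simpa [E_same] using h3
    funext i l
    refine (key l (fun j l => w l j l) (w l) (fun _ => rfl) i).trans ?_
    rw [hw]
    simp [E_same]
  · intro y
    choose v hv using fun l => hf (y l)
    refine ⟨f (fun i l => v l i l), fun l => ?_⟩
    rw [← hv, ← map_smul, ← map_smul]
    congr 1
    funext i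
    simp only [Pi.smul_apply, smul_eq_mul]
    rw [E_mul_z, E_mul_z]

/-- digit expansion -/
theorem exists_digit (l : PrimesNe p) (a : Zhat p) : ∃ (c : Fin l.1) (b : Zhat p), a = c.1 + l.1 * b := by
  have h : ∀ l' : PrimesNe p, ∃ b : Zl p l', a l' = ((a l).zmodRepr : Zl p l') + (l.1 : Zl p l') * b := by
    intro l'
    by_cases e : l' = l
    · subst e
      have := PadicInt.sub_zmodRepr_mem (a l')
      rw [PadicInt.maximalIdeal_eq_span_p, Ideal.mem_span_singleton] at this
      obtain ⟨b, hb⟩ := this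
      exact ⟨b, by rw [← hb]; ring⟩
    · obtain ⟨u, hu⟩ := exists_unit l' l.1 l.2.1.pos
      have : l.1.factorization l'.1 = 0 := by
        apply Nat.factorization_eq_zero_of_not_dvd
        intro hd
        exact e (Subtype.ext ((Nat.prime_dvd_prime_iff_eq l'.2.1 l.2.1).1 hd))
      rw [this, pow_zero, Nat.cast_one] at hu
      refine ⟨u * (a l' - ((a l).zmodRepr : Zl p l')), ?_⟩
      rw [← mul_assoc, hu]; ring
  choose b hb using h
  refine ⟨⟨(a l).zmodRepr, PadicInt.zmodRepr_lt_p _⟩, b, ?_⟩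
  funext l'
  simpa using hb l'

theorem bdd_of_finite (h : Module.Finite (Zhat p) M) : ∃ C : ℕ, ∀ l : PrimesNe p,
      Finite (M ⧸ AddMonoidHom.range ((l.1 : ℕ) • AddMonoidHom.id M)) ∧
      Nat.card (M ⧸ AddMonoidHom.range ((l.1 : ℕ) • AddMonoidHom.id M)) ≤ l.1 ^ C := by
  obtain ⟨C, f, hf⟩ := Module.Finite.exists_fin' (Zhat p) M
  refine ⟨C, fun l => ?_⟩
  let F : (Fin C → Fin l.1) → (M ⧸ AddMonoidHom.range ((l.1 : ℕ) • AddMonoidHom.id M)) :=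
    fun c => QuotientAddGroup.mk (f (fun i => ((c i).1 : Zhat p)))
  have hF : Function.Surjective F := by
    intro q
    obtain ⟨x, rfl⟩ := QuotientAddGroup.mk_surjective q
    obtain ⟨v, rfl⟩ := hf x
    choose c b hcb using fun i => exists_digit l (v i)
    refine ⟨c, ?_⟩
    apply QuotientAddGroup.eq.2
    refine ⟨f b, ?_⟩
    change l.1 • f b = _
    rw [← map_nsmul, ← map_neg, ← map_add]
    congr 1
    funext i
    simp only [Pi.add_apply, Pi.neg_apply, Pi.smul_apply]
    rw [hcb i, nsmul_eq_mul]; ring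
  refine ⟨Finite.of_surjective F hF, ?_⟩
  have := Nat.card_le_card_of_surjective F hF
  simpa using this

variable (M) in
def CInj (p : ℕ) : Prop := ∀ x : M, (∀ m : ℕ, 0 < m → m.Coprime p → ∃ z : M, x = m • z) → x = 0
variable (M) in
def CSurj (p : ℕ) : Prop := ∀ Y : ℕ → M,
  (∀ m m' : ℕ, 0 < m' → m'.Coprime p → m ∣ m' → ∃ z : M, Y m' - Y m = m • z) →
    ∃ x : M, ∀ m : ℕ, 0 < m → m.Coprime p → ∃ z : M, x - Y m = m • z

theorem cop (hp : p.Prime) (l : PrimesNe p) (n : ℕ) : (l.1 ^ n).Coprime p :=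
  Nat.Coprime.pow_left _ ((Nat.coprime_primes l.2.1 hp).2 l.2.2)

theorem sep_of_cinj (h : CInj M p) (l : PrimesNe p) : Sep M p l := by
  intro y hy
  apply h
  intro m hm _
  obtain ⟨z, hz⟩ := hy (m.factorization l.1)
  obtain ⟨w, hw⟩ := mem_of_pow l m hm y z hz
  exact ⟨_, hw⟩

/-- primes dividing m -/
noncomputable def S (p m : ℕ) : Finset (PrimesNe p) :=
  m.primeFactors.subtype (fun l => l.Prime ∧ l ≠ p)

theorem mem_S {m : ℕ} (hm : 0 < m) (l : PrimesNe p) : l ∈ S p m ↔ l.1 ∣ m := by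
  simp [S, l.2.1, hm.ne']

theorem mem_of_not_dvd (l : PrimesNe p) (m : ℕ) (hm : 0 < m) (h : ¬ l.1 ∣ m) (y : M) :
    ∃ w, E l 1 • y = m • E l 1 • w := by
  apply mem_of_pow l m hm y (E l 1 • y)
  rw [Nat.factorization_eq_zero_of_not_dvd h, pow_zero, one_smul]

theorem E_sum_S (l : PrimesNe p) (s : Finset (PrimesNe p)) (hl : l ∈ s) (y : PrimesNe p → M) :
    E l 1 • ∑ l' ∈ s, E l' 1 • y l' = E l 1 • y l := by
  rw [Finset.smul_sum, Finset.sum_eq_single l]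
  · rw [ee, one_mul]
  · intro b _ hb
    exact ee_ne hb.symm _ _ _
  · exact fun h => absurd hl h

theorem inj_of_cinj (h : CInj M p) : Inj M p := by
  intro x hx
  apply h
  intro m hm _
  have : ∀ l : PrimesNe p, ∃ b : Zl p l, (1 - ∑ l' ∈ S p m, E l' 1 : Zhat p) l = m * b := by
    intro l
    by_cases hl : l.1 ∣ m
    · refine ⟨0, ?_⟩
      have h1 := E_sum_S (M := Zhat p) l (S p m) ((mem_S hm l).2 hl) (fun _ => 1)
      have h2 := congrFun h1 l
      simp only [smul_eq_mul, mul_one, Pi.mul_apply, E_same, one_mul] at h2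
      rw [Pi.sub_apply, h2]; simp
    · obtain ⟨u, hu⟩ := exists_unit l m hm
      rw [Nat.factorization_eq_zero_of_not_dvd hl, pow_zero, Nat.cast_one] at hu
      exact ⟨u * (1 - ∑ l' ∈ S p m, E l' 1 : Zhat p) l, by rw [← mul_assoc, hu, one_mul]⟩
  choose b hb using this
  refine ⟨(b : Zhat p) • x, ?_⟩
  have h1 : (1 - ∑ l' ∈ S p m, E l' 1 : Zhat p) = (m : Zhat p) * b := by
    funext l; rw [hb]; simp
  rw [← Nat.cast_smul_eq_nsmul (Zhat p), smul_smul, ← h1, sub_smul, one_smul, Finset.sum_smul,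
    Finset.sum_eq_zero (fun l _ => hx l), sub_zero]

theorem surj_of_c (hp : p.Prime) (h : CInj M p) (hs : CSurj M p) : Surj M p := by
  intro y
  obtain ⟨x, hx⟩ := hs (fun m => ∑ l ∈ S p m, E l 1 • y l) (by
    intro m m' hm' _ hd
    have hm : 0 < m := Nat.pos_of_dvd_of_pos hd hm'
    have hsub : S p m ⊆ S p m' := fun l hl => (mem_S hm' l).2 (((mem_S hm l).1 hl).trans hd)
    classical
    rw [← Finset.sum_sdiff hsub, add_sub_cancel_right]
    have : ∀ l : PrimesNe p, ∃ w : M, l ∈ S p m' \ S p m → E l 1 • y l = m • w := by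
      intro l
      by_cases hl : l ∈ S p m
      · exact ⟨0, fun h => absurd hl (Finset.mem_sdiff.1 h).2⟩
      · obtain ⟨w, hw⟩ := mem_of_not_dvd l m hm (fun h => hl ((mem_S hm l).2 h)) (y l)
        exact ⟨_, fun _ => hw⟩
    choose w hw using this
    exact ⟨∑ l ∈ S p m' \ S p m, w l, by rw [Finset.smul_sum]; exact Finset.sum_congr rfl hw⟩)
  refine ⟨x, fun l => ?_⟩
  rw [← sub_eq_zero, ← smul_sub]
  apply sep_of_cinj h l
  intro n
  have hpos : 0 < l.1 ^ (n+1) := pow_pos l.2.1.pos _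
  obtain ⟨z, hz⟩ := hx (l.1 ^ (n+1)) hpos (cop hp l _)
  refine ⟨E l 1 • l.1 • z, ?_⟩
  have h1 := congrArg (fun t => E l 1 • t) hz
  simp only [smul_sub] at h1
  rw [E_sum_S l _ ((mem_S hpos l).2 (dvd_pow_self _ (Nat.succ_ne_zero n)))] at h1
  rw [smul_sub, h1, pow_succ, mul_smul, smul_comm]

theorem cinj_of (hp : p.Prime) (hI : Inj M p) (hSep : ∀ l, Sep M p l) : CInj M p := by
  intro x hx
  apply hI
  intro l
  apply hSep l
  intro n
  obtain ⟨z, hz⟩ := hx (l.1 ^ n) (pow_pos l.2.1.pos _) (cop hp l _)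
  exact ⟨E l 1 • z, by rw [hz, smul_comm]⟩

theorem csurj_of (hp : p.Prime) (hfin : Module.Finite (Zhat p) M) (hI : Inj M p) (hS : Surj M p) :
    CSurj M p := by
  intro Y hY
  obtain ⟨C, f, hf⟩ := Module.Finite.exists_fin' (Zhat p) M
  have hl : ∀ l : PrimesNe p, ∃ y : M, ∀ n, ∃ z : M, E l 1 • (y - Y (l.1 ^ n)) = l.1 ^ n • z := by
    intro l
    have : ∀ n, ∃ w, Y (l.1 ^ (n+1)) - Y (l.1 ^ n) = l.1 ^ n • f w := by
      intro n
      obtain ⟨z, hz⟩ := hY (l.1 ^ n) (l.1 ^ (n+1)) (pow_pos l.2.1.pos _) (cop hp l _)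
        (pow_dvd_pow _ (Nat.le_succ n))
      obtain ⟨w, rfl⟩ := hf z
      exact ⟨w, hz⟩
    choose w hw using this
    choose v hv using fun i => exists_lim l (fun n => w n i l)
    have hsum : ∀ n, Y (l.1 ^ n) = Y 1 + f (∑ k ∈ Finset.range n, l.1 ^ k • w k) := by
      intro n
      induction n with
      | zero => simp
      | succ n ih =>
        rw [Finset.sum_range_succ, map_add, ← add_assoc, ← ih, map_nsmul, ← hw]; abel
    refine ⟨Y 1 + f (fun i => E l (v i)), fun n => ?_⟩
    choose b hb using fun i => hv i n
    refine ⟨f (fun i => E l (b i)), ?_⟩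
    rw [hsum, add_sub_add_left_eq_sub, ← map_sub, ← map_smul, ← map_nsmul]
    congr 1
    funext i
    simp only [Pi.smul_apply, Pi.sub_apply, smul_eq_mul, nsmul_eq_mul, Finset.sum_apply]
    rw [E_mul_z, ← E_nat]
    congr 1
    simp only [Pi.sub_apply, E_same, Finset.sum_apply, Pi.mul_apply, one_mul, Pi.natCast_apply]
    rw [hb i]
    push_cast
    ring
  choose y hy using hl
  obtain ⟨x, hx⟩ := hS y
  refine ⟨x, fun m hm hmp => ?_⟩
  have : ∀ l : PrimesNe p, ∃ w, E l 1 • (x - Y m) = m • E l 1 • w := by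
    intro l
    obtain ⟨z, hz⟩ := hy l (m.factorization l.1)
    obtain ⟨z', hz'⟩ := hY (l.1 ^ m.factorization l.1) m hm hmp (Nat.ordProj_dvd m l.1)
    apply mem_of_pow l m hm (x - Y m) (z - E l 1 • z')
    rw [smul_sub (l.1 ^ m.factorization l.1), ← hz, smul_comm (l.1 ^ m.factorization l.1), ← hz',
      smul_sub, hx, smul_sub, smul_sub]
    abel
  choose w hw using this
  obtain ⟨W, hW⟩ := hS w
  refine ⟨W, ?_⟩
  rw [← sub_eq_zero]
  apply hI
  intro l
  rw [smul_sub, hw, smul_comm (E l 1) m W, hW, sub_self]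

end ZhatAux

/-- For a module `M` over `ℤ^p = ∏_{ℓ ≠ p} ℤ_ℓ` the following are
equivalent:
(a) `M` is finitely presented;
(b) each `ℤ_ℓ ⊗_{ℤ^p} M` is a finitely generated `ℤ_ℓ`-module, the natural map
`M → ∏_{ℓ ≠ p} ℤ_ℓ ⊗_{ℤ^p} M` is an isomorphism, and `dim_{𝔽_ℓ} (M/ℓM)` is bounded
independently of `ℓ` (expressed as: `M/ℓM` is finite of cardinality at most `ℓ^C`);
(c) the natural map `M → lim_{(m,p)=1} M/mM` is an isomorphism (expressed as:
the map to `∏ M/mM` is injective with range the set of compatible families), and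
`dim_{𝔽_ℓ} (M/ℓM)` is bounded independently of `ℓ`. -/
theorem finitePresentation_iff_over_Zhat
    (p : ℕ) (hp : p.Prime) (M : Type*) [AddCommGroup M] [Module (Zhat p) M] :
    letI bddDim : Prop := ∃ C : ℕ, ∀ l : PrimesNe p,
      Finite (M ⧸ AddMonoidHom.range ((l.1 : ℕ) • AddMonoidHom.id M)) ∧
      Nat.card (M ⧸ AddMonoidHom.range ((l.1 : ℕ) • AddMonoidHom.id M)) ≤ l.1 ^ C
    letI msub : {m : ℕ // 0 < m ∧ Nat.Coprime m p} → AddSubgroup M := fun m =>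
      AddMonoidHom.range ((m.1 : ℕ) • AddMonoidHom.id M)
    letI ψ : M → ∀ m : {m : ℕ // 0 < m ∧ Nat.Coprime m p}, M ⧸ msub m := fun x m =>
      QuotientAddGroup.mk x
    ((Module.FinitePresentation (Zhat p) M ↔
      ((∀ l : PrimesNe p, Module.Finite (Zl p l) ((Zl p l) ⊗[Zhat p] M)) ∧
        Function.Bijective
          (fun (x : M) (l : PrimesNe p) => (1 : Zl p l) ⊗ₜ[Zhat p] x) ∧
        bddDim)) ∧
    (Module.FinitePresentation (Zhat p) M ↔
      ((Function.Injective ψ ∧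
        ∀ f : (∀ m : {m : ℕ // 0 < m ∧ Nat.Coprime m p}, M ⧸ msub m),
          (f ∈ Set.range ψ ↔
            ∀ m m' : {m : ℕ // 0 < m ∧ Nat.Coprime m p}, (m.1 : ℕ) ∣ m'.1 →
              ∀ x : M, QuotientAddGroup.mk x = f m' →
                (QuotientAddGroup.mk x : M ⧸ msub m) = f m)) ∧
        bddDim))) := by
  have hmem : ∀ (m : ℕ) (x : M), x ∈ AddMonoidHom.range (m • AddMonoidHom.id M) ↔ ∃ z : M, x = m • z :=
    fun m x => ⟨fun ⟨z, hz⟩ => ⟨z, hz.symm⟩, fun ⟨z, hz⟩ => ⟨z, hz.symm⟩⟩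
  have hmk : ∀ (m : ℕ) (x y : M), (QuotientAddGroup.mk x : M ⧸ AddMonoidHom.range (m • AddMonoidHom.id M)) =
      QuotientAddGroup.mk y ↔ ∃ z : M, x - y = m • z := by
    intro m x y
    rw [eq_comm, QuotientAddGroup.eq, hmem, neg_add_eq_sub]
  refine ⟨⟨fun h => ?_, fun h => ?_⟩, ⟨fun h => ?_, fun h => ?_⟩⟩
  · exact ⟨fun l => inferInstance, ZhatAux.bij_iff.2 (ZhatAux.inj_surj_of_fp h),
      ZhatAux.bdd_of_finite inferInstance⟩
  · obtain ⟨h1, h2, C, hC⟩ := h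
    obtain ⟨hI, hS⟩ := ZhatAux.bij_iff.1 h2
    exact ZhatAux.fp_of hI hS (fun l => ZhatAux.sep_of_finite l (h1 l)) C hC
  · obtain ⟨hI, hS⟩ := ZhatAux.inj_surj_of_fp h
    have hci := ZhatAux.cinj_of hp hI (fun l => ZhatAux.sep_of_finite l inferInstance)
    have hcs := ZhatAux.csurj_of hp inferInstance hI hS
    refine ⟨⟨?_, ?_⟩, ZhatAux.bdd_of_finite inferInstance⟩
    · intro x y hxy
      rw [← sub_eq_zero]
      apply hci
      intro m hm hmp
      exact (hmk m x y).1 (congrFun hxy ⟨m, hm, hmp⟩)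
    · intro f
      constructor
      · rintro ⟨x0, rfl⟩ m m' ⟨d, hd⟩ x hx
        obtain ⟨z, hz⟩ := (hmk m'.1 x x0).1 hx
        exact (hmk m.1 x x0).2 ⟨d • z, by rw [hz, hd, mul_smul]⟩
      · intro hf
        choose Y0 hY0 using fun m => QuotientAddGroup.mk_surjective (f m)
        let Y : ℕ → M := fun m => if hm : 0 < m ∧ Nat.Coprime m p then Y0 ⟨m, hm⟩ else 0
        have hY : ∀ m (hm : 0 < m ∧ Nat.Coprime m p), Y m = Y0 ⟨m, hm⟩ := fun m hm => dif_pos hm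
        obtain ⟨x, hx⟩ := hcs Y (by
          intro m m' hm' hmp' hd
          have hm : 0 < m ∧ Nat.Coprime m p :=
            ⟨Nat.pos_of_dvd_of_pos hd hm', Nat.Coprime.coprime_dvd_left hd hmp'⟩
          rw [hY m hm, hY m' ⟨hm', hmp'⟩]
          apply (hmk m _ _).1
          exact (hf ⟨m, hm⟩ ⟨m', hm', hmp'⟩ hd _ (hY0 _)).trans (hY0 ⟨m, hm⟩).symm)
        refine ⟨x, ?_⟩
        funext m
        rw [← hY0 m]
        apply (hmk m.1 _ _).2
        rw [← hY m.1 m.2]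
        exact hx m.1 m.2.1 m.2.2
  · obtain ⟨⟨hinj, hrange⟩, C, hC⟩ := h
    have hci : ZhatAux.CInj M p := by
      intro x hx
      apply hinj
      funext m
      apply (hmk m.1 _ _).2
      rw [sub_zero]
      exact hx m.1 m.2.1 m.2.2
    have hcs : ZhatAux.CSurj M p := by
      intro Y hY
      obtain ⟨x, hx⟩ := (hrange (fun m => QuotientAddGroup.mk (Y m.1))).2 (by
        intro m m' hd x hx
        obtain ⟨z, hz⟩ := (hmk m'.1 _ _).1 hx
        obtain ⟨z', hz'⟩ := hY m.1 m'.1 m'.2.1 m'.2.2 hd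
        obtain ⟨d, hd⟩ := hd
        refine (hmk m.1 _ _).2 ⟨d • z + z', ?_⟩
        rw [smul_add, ← hz', smul_smul, ← hd, ← hz]; abel)
      exact ⟨x, fun m hm hmp => (hmk m _ _).1 (congrFun hx ⟨m, hm, hmp⟩)⟩
    exact ZhatAux.fp_of (ZhatAux.inj_of_cinj hci) (ZhatAux.surj_of_c hp hci hcs)
      (ZhatAux.sep_of_cinj hci) C hC
end

section
/- Let ℓ be a prime, let V and V' be finite-dimensional ℚ_ℓ-vector spaces equipped with automorphisms γ and γ' respectively, such that there is a ℚ_ℓ-linear isomorphism V → V' intertwining γ and γ'. Let ⟨ , ⟩ : V × V' → ℚ_ℓ be a nondegenerate ℚ_ℓ-bilinear pairing with ⟨γv, γ'v'⟩ = ⟨v, v'⟩ for all v, v'. Let A ⊆ Ker(γ − 1) and A' ⊆ Ker(γ' − 1) be ℚ-subspaces such that ⟨a, a'⟩ ∈ ℚ for all a ∈ A, a' ∈ A', and set N = {a ∈ A : ⟨a, a'⟩ = 0 for all a' ∈ A'}. Then the following are equivalent: (a) A/N is a finite-dimensional ℚ-vector space with dim_ℚ(A/N) = dim_{ℚ_ℓ}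 Ker(γ − 1); (e) A/N is a finite-dimensional ℚ-vector space whose ℚ-dimension equals the multiplicity of 1 as a root of the characteristic polynomial of γ on V. -/
theorem aux_key (ℓ : ℕ) [Fact ℓ.Prime]
    (V V' : Type*) [AddCommGroup V] [AddCommGroup V']
    [Module ℚ_[ℓ] V] [Module ℚ_[ℓ] V'] [FiniteDimensional ℚ_[ℓ] V]
    [Module ℚ V] [IsScalarTower ℚ ℚ_[ℓ] V] [Module ℚ V']
    (φ : V →ₗ[ℚ_[ℓ]] V' →ₗ[ℚ_[ℓ]] ℚ_[ℓ])
    (K : Submodule ℚ_[ℓ] V)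
    (A : Submodule ℚ V) (A' : Submodule ℚ V')
    (hA : ∀ a ∈ A, a ∈ K)
    (hQ : ∀ a ∈ A, ∀ a' ∈ A', ∃ r : ℚ, φ a a' = (r : ℚ_[ℓ]))
    (N : Submodule ℚ V)
    (hN : ∀ x : V, x ∈ N ↔ x ∈ A ∧ ∀ a' ∈ A', φ x a' = 0)
    (hfin : FiniteDimensional ℚ (A ⧸ N.comap A.subtype)) :
    Module.finrank ℚ (A ⧸ N.comap A.subtype) ≤ Module.finrank ℚ_[ℓ] K ∧
    (Module.finrank ℚ (A ⧸ N.comap A.subtype) = Module.finrank ℚ_[ℓ] K →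
      ∀ x ∈ K, (∀ a' ∈ A', φ x a' = 0) → x = 0) := by
  classical
  set r := Module.finrank ℚ (A ⧸ N.comap A.subtype) with hr
  let b : Module.Basis (Fin r) ℚ (A ⧸ N.comap A.subtype) := Module.finBasis _ _
  choose a ha using fun i => Submodule.mkQ_surjective (N.comap A.subtype) (b i)
  have key : ∀ c : Fin r → ℚ_[ℓ],
      (∀ a' ∈ A', ∑ i, c i * φ (a i : V) a' = 0) → ∀ i, c i = 0 := by
    intro c hc i
    rw [← Module.forall_dual_apply_eq_zero_iff ℚ]
    intro f
    have hmem : (∑ j, f (c j) • (a j : V)) ∈ N := by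
      rw [hN]
      refine ⟨A.sum_mem fun j _ => A.smul_mem _ (a j).2, fun a' ha' => ?_⟩
      choose q hq using fun j => hQ (a j) (a j).2 a' ha'
      have h1 := hc a' ha'
      simp only [hq] at h1
      have h2 : ∑ j, f (c j) * q j = 0 := by
        have := congrArg f h1
        rw [map_sum, map_zero] at this
        rw [← this]
        refine Finset.sum_congr rfl fun j _ => ?_
        rw [mul_comm (c j), ← Rat.smul_def, map_smul, smul_eq_mul, mul_comm]
      have h3 : ∀ j, f (c j) • (a j : V) = ((f (c j) : ℚ) : ℚ_[ℓ]) • (a j : V) := by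
        intro j
        rw [← algebraMap_smul ℚ_[ℓ] (f (c j)) (a j : V)]
        simp
      simp only [h3, map_sum, map_smul, LinearMap.sum_apply, LinearMap.smul_apply, hq, smul_eq_mul]
      exact_mod_cast h2
    have h0 : ∑ j, f (c j) • b j = 0 := by
      simp only [← ha, ← map_smul, ← map_sum]
      rw [Submodule.mkQ_apply, Submodule.Quotient.mk_eq_zero, Submodule.mem_comap]
      simpa using hmem
    exact Fintype.linearIndependent_iff.mp b.linearIndependent (fun j => f (c j)) h0 i
  let v : Fin r → K := fun i => ⟨a i, hA _ (a i).2⟩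
  have hv : LinearIndependent ℚ_[ℓ] v := by
    rw [Fintype.linearIndependent_iff]
    intro c hc
    apply key
    intro a' _
    have : (∑ i, c i • (a i : V)) = 0 := by
      simpa [v] using congrArg (Subtype.val) hc
    simpa using congrArg (fun x => φ x a') this
  refine ⟨by simpa using hv.fintype_card_le_finrank, fun heq x hx hx' => ?_⟩
  have hs := hv.span_eq_top_of_card_eq_finrank' (by simpa using heq)
  have hxs : (⟨x, hx⟩ : K) ∈ Submodule.span ℚ_[ℓ] (Set.range v) := by rw [hs]; trivial
  obtain ⟨c, hc⟩ := (Submodule.mem_span_range_iff_exists_fun _).mp hxs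
  have hc' : (∑ i, c i • (a i : V)) = x := by
    simpa [v] using congrArg (Subtype.val) hc
  have := key c (fun a' ha' => by simpa using (congrArg (fun x => φ x a') hc').trans (hx' a' ha'))
  rw [← hc']
  simp [this]


/-- Let `V, V'` be finite-dimensional `ℚ_ℓ`-vector spaces with
automorphisms `γ, γ'` intertwined by some isomorphism `V ≃ V'`, and let `⟨,⟩` be a
nondegenerate `γ`-invariant pairing `V × V' → ℚ_ℓ`.  Let `A ⊆ Ker (γ - 1)` and
`A' ⊆ Ker (γ' - 1)` be `ℚ`-subspaces pairing into `ℚ`, and let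
`N = {a ∈ A ∣ ⟨a, A'⟩ = 0}`.  Then the following are equivalent:
(a) `A/N` is finite-dimensional over `ℚ` with `dim_ℚ (A/N) = dim_{ℚ_ℓ} Ker (γ - 1)`;
(e) `A/N` is finite-dimensional over `ℚ` with `dim_ℚ (A/N)` equal to the multiplicity
of `1` as a root of the characteristic polynomial of `γ` on `V`. -/
theorem dim_fixed_iff_multiplicity_one
    (ℓ : ℕ) [Fact ℓ.Prime]
    (V V' : Type*) [AddCommGroup V] [AddCommGroup V']
    [Module ℚ_[ℓ] V] [Module ℚ_[ℓ] V']
    [FiniteDimensional ℚ_[ℓ] V] [FiniteDimensional ℚ_[ℓ] V']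
    (γ : V ≃ₗ[ℚ_[ℓ]] V) (γ' : V' ≃ₗ[ℚ_[ℓ]] V')
    (hiso : ∃ e : V ≃ₗ[ℚ_[ℓ]] V', ∀ v : V, e (γ v) = γ' (e v))
    (φ : V →ₗ[ℚ_[ℓ]] V' →ₗ[ℚ_[ℓ]] ℚ_[ℓ])
    (hnd₁ : ∀ v : V, (∀ v' : V', φ v v' = 0) → v = 0)
    (hnd₂ : ∀ v' : V', (∀ v : V, φ v v' = 0) → v' = 0)
    (hinv : ∀ (v : V) (v' : V'), φ (γ v) (γ' v') = φ v v') :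
    letI : Module ℚ V := Module.compHom V (algebraMap ℚ ℚ_[ℓ])
    letI : Module ℚ V' := Module.compHom V' (algebraMap ℚ ℚ_[ℓ])
    ∀ (A : Submodule ℚ V) (A' : Submodule ℚ V'),
      (∀ a ∈ A, γ a = a) → (∀ a' ∈ A', γ' a' = a') →
      (∀ a ∈ A, ∀ a' ∈ A', ∃ r : ℚ, φ a a' = (r : ℚ_[ℓ])) →
      ∀ N : Submodule ℚ V,
        (∀ x : V, x ∈ N ↔ x ∈ A ∧ ∀ a' ∈ A', φ x a' = 0) →
        ((FiniteDimensional ℚ (A ⧸ N.comap A.subtype) ∧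
            Module.finrank ℚ (A ⧸ N.comap A.subtype)
              = Module.finrank ℚ_[ℓ] (LinearMap.ker (γ.toLinearMap - LinearMap.id))) ↔
          (FiniteDimensional ℚ (A ⧸ N.comap A.subtype) ∧
            Module.finrank ℚ (A ⧸ N.comap A.subtype)
              = (LinearMap.charpoly γ.toLinearMap).rootMultiplicity 1)) := by
  let iQ : Module ℚ V := Module.compHom V (algebraMap ℚ ℚ_[ℓ])
  let iQ' : Module ℚ V' := Module.compHom V' (algebraMap ℚ ℚ_[ℓ])
  intro A A' hA hA' hQ N hN
  have : IsScalarTower ℚ ℚ_[ℓ] V := ⟨fun q x v => by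
    rw [Algebra.smul_def, mul_smul]; rfl⟩
  have hker : LinearMap.ker (γ.toLinearMap - LinearMap.id)
      = Module.End.eigenspace γ.toLinearMap 1 := by
    ext x
    simp [Module.End.mem_eigenspace_iff, sub_eq_zero]
  have hle : Module.finrank ℚ_[ℓ] (LinearMap.ker (γ.toLinearMap - LinearMap.id))
      ≤ (LinearMap.charpoly γ.toLinearMap).rootMultiplicity 1 := by
    rw [hker]
    exact LinearMap.finrank_eigenspace_le _ _
  have main := fun hfin => aux_key ℓ V V' φ
    (LinearMap.ker (γ.toLinearMap - LinearMap.id)) A A'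
    (fun a ha => by simp [hA a ha]) hQ N hN hfin
  constructor
  · rintro ⟨hfin, heq⟩
    refine ⟨hfin, heq.trans ?_⟩
    have hz := (main hfin).2 heq
    rw [← LinearMap.finrank_maxGenEigenspace_eq]
    have : LinearMap.ker (γ.toLinearMap - LinearMap.id)
        = Module.End.maxGenEigenspace γ.toLinearMap 1 := by
      apply le_antisymm
      · rw [hker]
        exact Module.End.genEigenspace_le_maximal _ _ 1
      · intro x hx
        rw [Module.End.mem_maxGenEigenspace] at hx
        obtain ⟨n, hn⟩ := hx
        rw [one_smul] at hn
        induction n generalizing x with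
        | zero =>
          have : x = 0 := by simpa using hn
          rw [this]; exact zero_mem _
        | succ n ih =>
          rw [pow_succ] at hn
          have h1 := ih hn
          rw [LinearMap.mem_ker]
          refine hz _ h1 fun a' ha' => ?_
          have h2 := hinv x a'
          rw [hA' a' ha'] at h2
          simp [h2]
    rw [this]
  · rintro ⟨hfin, heq⟩
    exact ⟨hfin, le_antisymm (main hfin).1 (heq ▸ hle)⟩
end

section
/- Let ℓ be a prime, q a power of a prime p ≠ ℓ (so q is a unit in ℤ_ℓ), and r an integer. Let X be a bounded cochain complex of ℤ_ℓ-modules whose cohomology modules H^j(X) are finitely generated over ℤ_ℓ, and let γ : X → X be an automorphism of complexes. Set γ_r = q^{−r}·γ and E^j = H^{j−1}(Cone(1 − γ_r : X → X)). Assume that for every j, q^r is not a multiple root of the minimal polynomial of the action of γ on H^j(X) ⊗_{ℤ_ℓ} ℚ_ℓ. Then each E^j is a finitely generated ℤ_ℓ-module, E^j = 0 for all but finitely many j, and the alternating sum of their ranks vanishes: Σ_j (−1)^j rank_{ℤ_ℓ} E^j = 0. -/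
open scoped TensorProduct

/-- The cohomology of a graded complex at degree `j`: the complex is presented as an
ambient module `V` with grading `X : ℤ → Submodule R V` and a differential
`D : V →ₗ[R] V` mapping `X i` into `X (i+1)`; the cohomology at `j` is
`(X j ∩ Ker D) / D (X (j-1))`. -/
abbrev gradedCoh {R V : Type*} [CommRing R] [AddCommGroup V] [Module R V]
    (X : ℤ → Submodule R V) (D : V →ₗ[R] V) (j : ℤ) : Type _ :=
  ↥(X j ⊓ LinearMap.ker D) ⧸
    Submodule.comap (X j ⊓ LinearMap.ker D).subtype (Submodule.map D (X (j - 1)))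

theorem coneAux_exact {R V : Type*} [CommRing R] [AddCommGroup V] [Module R V]
    (X : ℤ → Submodule R V) (D f : V →ₗ[R] V)
    (hD : ∀ i : ℤ, ∀ x ∈ X i, D x ∈ X (i + 1))
    (hf : ∀ i : ℤ, ∀ x ∈ X i, f x ∈ X i)
    (hfD : ∀ x : V, f (D x) = D (f x))
    (hDD : ∀ x : V, D (D x) = 0)
    (φ : ∀ j : ℤ, gradedCoh X D j →ₗ[R] gradedCoh X D j)
    (hφ : ∀ (j : ℤ) (x y : ↥(X j ⊓ LinearMap.ker D)), (y : V) = f (x : V) →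
      φ j (Submodule.Quotient.mk x) = Submodule.Quotient.mk y)
    (CX : ℤ → Submodule R (V × V)) (hCX : ∀ n, CX n = (X (n + 1)).prod (X n))
    (DC : V × V →ₗ[R] V × V) (hDC : ∀ a b, DC (a, b) = (- D a, f a + D b)) (n : ℤ) :
    ∃ (α : gradedCoh X D n →ₗ[R] gradedCoh CX DC n)
      (β : gradedCoh CX DC n →ₗ[R] gradedCoh X D (n + 1)),
      LinearMap.ker α = LinearMap.range (φ n) ∧
      LinearMap.range α = LinearMap.ker β ∧
      LinearMap.range β = LinearMap.ker (φ (n + 1)) := by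
  have hmem : ∀ (m : ℤ) (a b : V), (a, b) ∈ CX m ⊓ LinearMap.ker DC ↔
      (a ∈ X (m + 1) ∧ b ∈ X m) ∧ D a = 0 ∧ f a + D b = 0 := by
    intro m a b
    simp [hCX, hDC, Submodule.mem_prod]
  have hmemX : ∀ (m : ℤ) (a : V), a ∈ X m ⊓ LinearMap.ker D ↔ a ∈ X m ∧ D a = 0 := by
    intro m a; simp
  have hαm : ∀ x ∈ X n ⊓ LinearMap.ker D,
      LinearMap.inr R V V x ∈ CX n ⊓ LinearMap.ker DC := by
    intro x hx
    rw [hmemX] at hx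
    rw [LinearMap.inr_apply, hmem]
    simp [hx]
  have hβm : ∀ x ∈ CX n ⊓ LinearMap.ker DC,
      LinearMap.fst R V V x ∈ X (n + 1) ⊓ LinearMap.ker D := by
    rintro ⟨a, b⟩ hx
    rw [hmem] at hx
    rw [LinearMap.fst_apply, hmemX]
    exact ⟨hx.1.1, hx.2.1⟩
  have hαm' : ∀ x ∈ X n ⊓ LinearMap.ker D, ((0, x) : V × V) ∈ CX n ⊓ LinearMap.ker DC := hαm
  have hβm' : ∀ a b : V, (a, b) ∈ CX n ⊓ LinearMap.ker DC → a ∈ X (n + 1) ⊓ LinearMap.ker D :=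
    fun a b hx => hβm (a, b) hx
  have e1 : n - 1 + 1 = n := by ring
  have e2 : n + 1 - 1 = n := by ring
  let α : gradedCoh X D n →ₗ[R] gradedCoh CX DC n :=
    Submodule.mapQ _ _ ((LinearMap.inr R V V).restrict hαm) (by
      rintro ⟨x, hx⟩ ⟨y, hy, hyx⟩
      refine ⟨(0, y), ?_, ?_⟩
      · have : y ∈ X (n - 1) := hy
        simp [hCX, this]
      · have : D y = x := hyx
        simp [hDC, this])
  let β : gradedCoh CX DC n →ₗ[R] gradedCoh X D (n + 1) :=
    Submodule.mapQ _ _ ((LinearMap.fst R V V).restrict hβm) (by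
      rintro ⟨⟨a, b⟩, hx⟩ ⟨⟨a', b'⟩, hy, hyx⟩
      rw [hDC] at hyx
      have h1 : - D a' = a := congrArg Prod.fst hyx
      replace hy : (a', b') ∈ CX (n - 1) := hy
      rw [hCX, Submodule.mem_prod, e1] at hy
      refine ⟨- a', ?_, ?_⟩
      · rw [e2]; exact neg_mem hy.1
      · simp [h1])
  have hα : ∀ (x : V) (hx : x ∈ X n ⊓ LinearMap.ker D),
      α (Submodule.Quotient.mk ⟨x, hx⟩) = Submodule.Quotient.mk ⟨(0, x), hαm' x hx⟩ :=
    fun x hx => rfl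
  have hβ : ∀ (a b : V) (hx : (a, b) ∈ CX n ⊓ LinearMap.ker DC),
      β (Submodule.Quotient.mk ⟨(a, b), hx⟩) = Submodule.Quotient.mk ⟨a, hβm' a b hx⟩ :=
    fun a b hx => rfl
  have z1 : ∀ (m m' : ℤ) (_ : m - 1 = m') (x : V) (hx : x ∈ X m ⊓ LinearMap.ker D),
      (Submodule.Quotient.mk ⟨x, hx⟩ : gradedCoh X D m) = 0 ↔ ∃ y ∈ X m', D y = x := by
    rintro m m' rfl x hx
    rw [Submodule.Quotient.mk_eq_zero]
    exact Iff.rfl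
  have q1 : ∀ (m m' : ℤ) (_ : m - 1 = m') (x y : V) (hx : x ∈ X m ⊓ LinearMap.ker D)
      (hy : y ∈ X m ⊓ LinearMap.ker D),
      (Submodule.Quotient.mk ⟨x, hx⟩ : gradedCoh X D m) = Submodule.Quotient.mk ⟨y, hy⟩ ↔
        ∃ z ∈ X m', D z = x - y := by
    rintro m m' rfl x y hx hy
    rw [Submodule.Quotient.eq]
    exact Iff.rfl
  have q2 : ∀ (x y : V × V) (hx : x ∈ CX n ⊓ LinearMap.ker DC)
      (hy : y ∈ CX n ⊓ LinearMap.ker DC),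
      (Submodule.Quotient.mk ⟨x, hx⟩ : gradedCoh CX DC n) = Submodule.Quotient.mk ⟨y, hy⟩ ↔
        ∃ z ∈ CX (n - 1), DC z = x - y := by
    intro x y hx hy
    rw [Submodule.Quotient.eq]
    exact Iff.rfl
  have z2 : ∀ (x : V × V) (hx : x ∈ CX n ⊓ LinearMap.ker DC),
      (Submodule.Quotient.mk ⟨x, hx⟩ : gradedCoh CX DC n) = 0 ↔
        ∃ z ∈ CX (n - 1), DC z = x := by
    intro x hx
    rw [Submodule.Quotient.mk_eq_zero]
    exact Iff.rfl
  have hfm : ∀ (m : ℤ) (x : V), x ∈ X m ⊓ LinearMap.ker D → f x ∈ X m ⊓ LinearMap.ker D := by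
    intro m x hx
    rw [hmemX] at hx ⊢
    exact ⟨hf _ _ hx.1, by rw [← hfD, hx.2, map_zero]⟩
  have hφ' : ∀ (m : ℤ) (x : V) (hx : x ∈ X m ⊓ LinearMap.ker D),
      φ m (Submodule.Quotient.mk ⟨x, hx⟩) = Submodule.Quotient.mk ⟨f x, hfm m x hx⟩ :=
    fun m x hx => hφ m _ _ rfl
  refine ⟨α, β, ?_, ?_, ?_⟩
  · ext w
    obtain ⟨⟨x, hx⟩, rfl⟩ := Submodule.Quotient.mk_surjective _ w
    rw [LinearMap.mem_ker, hα, z2, LinearMap.mem_range]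
    constructor
    · rintro ⟨⟨a, b⟩, hz, h⟩
      rw [hDC, Prod.mk.injEq, neg_eq_zero] at h
      rw [hCX, Submodule.mem_prod, e1] at hz
      refine ⟨Submodule.Quotient.mk ⟨a, (hmemX _ _).2 ⟨hz.1, h.1⟩⟩, ?_⟩
      rw [hφ', q1 _ _ rfl]
      refine ⟨-b, neg_mem hz.2, ?_⟩
      rw [← h.2, map_neg]; abel
    · rintro ⟨w, hw⟩
      obtain ⟨⟨a, ha⟩, rfl⟩ := Submodule.Quotient.mk_surjective _ w
      rw [hφ', q1 _ _ rfl] at hw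
      obtain ⟨b, hb, h⟩ := hw
      have ha' := (hmemX _ _).1 ha
      refine ⟨(a, -b), ?_, ?_⟩
      · rw [hCX, Submodule.mem_prod, e1]
        exact ⟨ha'.1, neg_mem hb⟩
      · rw [hDC, map_neg, h, ha'.2]
        simp
  · ext w
    obtain ⟨⟨⟨a, b⟩, hx⟩, rfl⟩ := Submodule.Quotient.mk_surjective _ w
    rw [LinearMap.mem_ker, hβ, z1 _ _ e2, LinearMap.mem_range]
    constructor
    · rintro ⟨w, hw⟩
      obtain ⟨⟨x, hx'⟩, rfl⟩ := Submodule.Quotient.mk_surjective _ w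
      rw [hα, q2] at hw
      obtain ⟨⟨a', b'⟩, hz, h⟩ := hw
      rw [hCX, Submodule.mem_prod, e1] at hz
      rw [hDC] at h
      have h1 : - D a' = 0 - a := congrArg Prod.fst h
      refine ⟨a', hz.1, ?_⟩
      rw [zero_sub, neg_inj] at h1
      exact h1
    · rintro ⟨a', ha', h⟩
      have hx' := (hmem _ _ _).1 hx
      refine ⟨Submodule.Quotient.mk ⟨b + f a', (hmemX _ _).2
        ⟨add_mem hx'.1.2 (hf _ _ ha'), ?_⟩⟩, ?_⟩
      · rw [map_add, ← hfD, h, add_comm]; exact hx'.2.2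
      · rw [hα, q2]
        refine ⟨(a', 0), ?_, ?_⟩
        · rw [hCX, Submodule.mem_prod, e1]
          exact ⟨ha', zero_mem _⟩
        · rw [hDC, h]
          simp
  · ext w
    obtain ⟨⟨a, ha⟩, rfl⟩ := Submodule.Quotient.mk_surjective _ w
    rw [LinearMap.mem_ker, hφ', z1 _ _ e2, LinearMap.mem_range]
    constructor
    · rintro ⟨w, hw⟩
      obtain ⟨⟨⟨a', b'⟩, hx⟩, rfl⟩ := Submodule.Quotient.mk_surjective _ w
      rw [hβ, q1 _ _ e2] at hw
      obtain ⟨z, hz, h⟩ := hw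
      have hx' := (hmem _ _ _).1 hx
      refine ⟨- b' - f z, sub_mem (neg_mem hx'.1.2) (hf _ _ hz), ?_⟩
      have h3 : D b' = - f a' := eq_neg_of_add_eq_zero_right hx'.2.2
      rw [map_sub, map_neg, h3, ← hfD, h, map_sub]; abel
    · rintro ⟨b, hb, h⟩
      have ha' := (hmemX _ _).1 ha
      refine ⟨Submodule.Quotient.mk ⟨(a, -b), (hmem _ _ _).2
        ⟨⟨ha'.1, neg_mem hb⟩, ha'.2, ?_⟩⟩, ?_⟩
      · rw [map_neg, h]; abel
      · rw [hβ]

theorem coneAux_rank {R A B C : Type*} [CommRing R] [IsDomain R] [IsNoetherianRing R]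
    [AddCommGroup A] [Module R A] [AddCommGroup B] [Module R B] [AddCommGroup C] [Module R C]
    [Module.Finite R A] [Module.Finite R C]
    (φ : A →ₗ[R] A) (ψ : C →ₗ[R] C) (α : A →ₗ[R] B) (β : B →ₗ[R] C)
    (h1 : LinearMap.ker α = LinearMap.range φ) (h2 : LinearMap.range α = LinearMap.ker β)
    (h3 : LinearMap.range β = LinearMap.ker ψ) :
    Module.Finite R B ∧ Module.finrank R B =
      Module.finrank R (LinearMap.ker φ) + Module.finrank R (LinearMap.ker ψ) := by
  have hN : IsNoetherian R B := isNoetherian_of_range_eq_ker α β h2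
  have hB : Module.Finite R B := inferInstance
  refine ⟨hB, ?_⟩
  have a1 := Submodule.finrank_quotient_add_finrank (LinearMap.ker β)
  rw [β.quotKerEquivRange.finrank_eq] at a1
  have a2 := Submodule.finrank_quotient_add_finrank (LinearMap.ker α)
  rw [α.quotKerEquivRange.finrank_eq] at a2
  have a3 := Submodule.finrank_quotient_add_finrank (LinearMap.ker φ)
  rw [φ.quotKerEquivRange.finrank_eq] at a3
  rw [← h2, h3] at a1
  rw [h1] at a2
  omega

theorem coneAux_sum (a : ℤ → ℕ) (n₀ : ℕ) (ha : ∀ j : ℤ, (n₀ : ℤ) < |j| → a j = 0) :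
    (∑ᶠ j : ℤ, ((j.negOnePow : ℤ) * ((a (j - 1) + a j : ℕ) : ℤ))) = 0 := by
  have hfin : (Function.support fun j : ℤ => ((j.negOnePow : ℤ) * (a j : ℤ))).Finite := by
    refine (Set.finite_Icc (-(n₀ : ℤ)) n₀).subset ?_
    intro j hj
    by_contra h
    apply hj
    have : (n₀ : ℤ) < |j| := by
      by_contra h'
      exact h (abs_le.1 (not_lt.1 h'))
    simp [ha j this]
  have hfin2 : (Function.support fun j : ℤ => ((j.negOnePow : ℤ) * (a (j - 1) : ℤ))).Finite := by
    refine (Set.finite_Icc (-(n₀ : ℤ) + 1) (n₀ + 1)).subset ?_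
    intro j hj
    by_contra h
    apply hj
    have : (n₀ : ℤ) < |j - 1| := by
      by_contra h'
      have := abs_le.1 (not_lt.1 h')
      exact h ⟨by linarith [this.1], by linarith [this.2]⟩
    simp [ha (j - 1) this]
  have e : ∀ j : ℤ, ((j.negOnePow : ℤ) * ((a (j - 1) + a j : ℕ) : ℤ)) =
      (j.negOnePow : ℤ) * (a (j - 1) : ℤ) + (j.negOnePow : ℤ) * (a j : ℤ) := by
    intro j; push_cast; ring
  rw [finsum_congr e, finsum_add_distrib hfin2 hfin]
  rw [← finsum_comp_equiv (Equiv.addRight (1 : ℤ))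
    (f := fun j : ℤ => ((j.negOnePow : ℤ) * (a (j - 1) : ℤ)))]
  have e' : ∀ j : ℤ, (((Equiv.addRight (1 : ℤ)) j).negOnePow : ℤ) *
      (a ((Equiv.addRight (1 : ℤ)) j - 1) : ℤ) = - ((j.negOnePow : ℤ) * (a j : ℤ)) := by
    intro j
    simp [Int.negOnePow_succ]
  rw [finsum_congr e', finsum_neg_distrib]
  simp

theorem coneAux_main (ℓ : ℕ) [Fact ℓ.Prime] (c : ℤ_[ℓ])
    (V : Type) [AddCommGroup V] [Module ℤ_[ℓ] V]
    (X : ℤ → Submodule ℤ_[ℓ] V)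
    (n₀ : ℕ) (hbdd : ∀ j : ℤ, (n₀ : ℤ) < |j| → X j = ⊥)
    (D : V →ₗ[ℤ_[ℓ]] V) (hD : ∀ i : ℤ, ∀ x ∈ X i, D x ∈ X (i + 1))
    (hDD : ∀ x : V, D (D x) = 0)
    (U : V ≃ₗ[ℤ_[ℓ]] V) (hUX : ∀ i : ℤ, ∀ x ∈ X i, U x ∈ X i)
    (hUD : ∀ x : V, U (D x) = D (U x))
    (hfg : ∀ j : ℤ, Module.Finite ℤ_[ℓ] (gradedCoh X D j))
    (γH : ∀ j : ℤ, gradedCoh X D j →ₗ[ℤ_[ℓ]] gradedCoh X D j)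
    (hγH : ∀ (j : ℤ) (x y : ↥(X j ⊓ LinearMap.ker D)), (y : V) = U (x : V) →
      γH j (Submodule.Quotient.mk x) = Submodule.Quotient.mk y)
    (CX : ℤ → Submodule ℤ_[ℓ] (V × V)) (hCX : ∀ n, CX n = (X (n + 1)).prod (X n))
    (DC : V × V →ₗ[ℤ_[ℓ]] V × V)
    (hDC : ∀ a b, DC (a, b) =
      (- D a, (LinearMap.id - c • (U : V →ₗ[ℤ_[ℓ]] V) : V →ₗ[ℤ_[ℓ]] V) a + D b)) :
    (∀ j : ℤ, Module.Finite ℤ_[ℓ] (gradedCoh CX DC (j - 1))) ∧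
    Set.Finite {j : ℤ | Nontrivial (gradedCoh CX DC (j - 1))} ∧
    (∑ᶠ j : ℤ, ((j.negOnePow : ℤ) *
      (Module.finrank ℚ_[ℓ] (ℚ_[ℓ] ⊗[ℤ_[ℓ]] gradedCoh CX DC (j - 1)) : ℤ))) = 0 := by
  set f : V →ₗ[ℤ_[ℓ]] V := LinearMap.id - c • (U : V →ₗ[ℤ_[ℓ]] V) with hf
  have hfa : ∀ x, f x = x - c • U x := fun x => rfl
  let φ : ∀ j : ℤ, gradedCoh X D j →ₗ[ℤ_[ℓ]] gradedCoh X D j :=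
    fun j => LinearMap.id - c • γH j
  have hex := coneAux_exact X D f hD
    (fun i x hx => by
      rw [hfa]; exact sub_mem hx (Submodule.smul_mem _ _ (hUX i x hx)))
    (fun x => by rw [hfa, hfa, map_sub, map_smul, hUD]) hDD φ
    (fun j x y hxy => by
      have hm : U (x : V) ∈ X j ⊓ LinearMap.ker D := by
        refine ⟨hUX _ _ x.2.1, ?_⟩
        have : D (x : V) = 0 := x.2.2
        change D (U (x : V)) = 0
        rw [← hUD, this, map_zero]
      have h1 := hγH j x ⟨U (x : V), hm⟩ rfl
      have hy : y = x - c • (⟨U (x : V), hm⟩ : ↥(X j ⊓ LinearMap.ker D)) :=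
        Subtype.ext hxy
      change Submodule.Quotient.mk x - c • γH j (Submodule.Quotient.mk x) = _
      rw [h1, hy]
      rfl)
    CX hCX DC hDC
  have key : ∀ n : ℤ, Module.Finite ℤ_[ℓ] (gradedCoh CX DC n) ∧
      Module.finrank ℤ_[ℓ] (gradedCoh CX DC n) =
        Module.finrank ℤ_[ℓ] (LinearMap.ker (φ n)) +
          Module.finrank ℤ_[ℓ] (LinearMap.ker (φ (n + 1))) := by
    intro n
    obtain ⟨α, β, h1, h2, h3⟩ := hex n
    haveI := hfg n
    haveI := hfg (n + 1)
    exact coneAux_rank (φ n) (φ (n + 1)) α β h1 h2 h3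
  have hz : ∀ j : ℤ, (n₀ : ℤ) < |j| → Module.finrank ℤ_[ℓ] (LinearMap.ker (φ j)) = 0 := by
    intro j hj
    have hb : X j ⊓ LinearMap.ker D = ⊥ := by rw [hbdd j hj, bot_inf_eq]
    haveI : Subsingleton ↥(X j ⊓ LinearMap.ker D) := by rw [hb]; infer_instance
    haveI : Subsingleton (gradedCoh X D j) :=
      (Submodule.Quotient.mk_surjective _).subsingleton
    exact Module.finrank_zero_of_subsingleton
  refine ⟨fun j => (key (j - 1)).1, ?_, ?_⟩
  · refine (Set.finite_Icc (-(n₀ : ℤ)) (n₀ + 1)).subset ?_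
    intro j hj
    by_contra h
    have hj1 : (n₀ : ℤ) < |j - 1| := by
      by_contra h'
      have := abs_le.1 (not_lt.1 h')
      exact h ⟨by linarith [this.1], by linarith [this.2]⟩
    have hj2 : (n₀ : ℤ) < |j - 1 + 1| := by
      by_contra h'
      have := abs_le.1 (not_lt.1 h')
      exact h ⟨by linarith [this.1], by linarith [this.2]⟩
    have hb : CX (j - 1) ⊓ LinearMap.ker DC = ⊥ := by
      rw [hCX, hbdd _ hj1, hbdd _ hj2, Submodule.prod_bot, bot_inf_eq]
    haveI : Subsingleton ↥(CX (j - 1) ⊓ LinearMap.ker DC) := by rw [hb]; infer_instance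
    haveI : Subsingleton (gradedCoh CX DC (j - 1)) :=
      (Submodule.Quotient.mk_surjective _).subsingleton
    exact not_nontrivial _ hj
  · have hr : ∀ j : ℤ, Module.finrank ℚ_[ℓ] (ℚ_[ℓ] ⊗[ℤ_[ℓ]] gradedCoh CX DC (j - 1)) =
        Module.finrank ℤ_[ℓ] (LinearMap.ker (φ (j - 1))) +
          Module.finrank ℤ_[ℓ] (LinearMap.ker (φ j)) := by
      intro j
      have h := (key (j - 1)).2
      rw [sub_add_cancel] at h
      rw [← h]
      haveI := (key (j - 1)).1
      exact (TensorProduct.isBaseChange ℤ_[ℓ] (gradedCoh CX DC (j - 1)) ℚ_[ℓ]).finrank_eq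
    simp_rw [hr]
    exact coneAux_sum (fun j => Module.finrank ℤ_[ℓ] (LinearMap.ker (φ j))) n₀ hz

/-- Let `ℓ` be a prime, `q` a power of a prime `p ≠ ℓ`, `r ∈ ℤ`.
Let `X` be a bounded cochain complex of `ℤ_ℓ`-modules with finitely generated
cohomology, `γ` an automorphism of complexes, and `E^j := H^{j-1}(Cone(1 - q^{-r} γ))`.
If for every `j` the minimal polynomial of `γ` on `H^j(X) ⊗ ℚ_ℓ` does not have `q^r` as
a multiple root, then each `E^j` is a finitely generated `ℤ_ℓ`-module, `E^j = 0` for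
all but finitely many `j`, and `∑_j (-1)^j rank E^j = 0` (the rank being
`dim_{ℚ_ℓ} (E^j ⊗ ℚ_ℓ)`).  The complex is presented as a graded module (`V`, `X`, `D`)
and the mapping cone lives in `V × V`, graded by `CX n = X (n+1) × X n`. -/
theorem cone_euler_characteristic_zero
    (ℓ : ℕ) [Fact ℓ.Prime] (p k : ℕ) (hp : p.Prime) (hpℓ : p ≠ ℓ) (hk : 0 < k)
    (q : ℕ) (hq : q = p ^ k) (r : ℤ)
    (uq : ℤ_[ℓ]ˣ) (huq : (uq : ℤ_[ℓ]) = (q : ℤ_[ℓ]))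
    (V : Type) [AddCommGroup V] [Module ℤ_[ℓ] V]
    (X : ℤ → Submodule ℤ_[ℓ] V)
    (n₀ : ℕ) (hbdd : ∀ j : ℤ, (n₀ : ℤ) < |j| → X j = ⊥)
    (D : V →ₗ[ℤ_[ℓ]] V) (hD : ∀ i : ℤ, ∀ x ∈ X i, D x ∈ X (i + 1))
    (hDD : ∀ x : V, D (D x) = 0)
    (U : V ≃ₗ[ℤ_[ℓ]] V) (hUX : ∀ i : ℤ, ∀ x ∈ X i, U x ∈ X i)
    (hUX' : ∀ i : ℤ, ∀ x ∈ X i, U.symm x ∈ X i)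
    (hUD : ∀ x : V, U (D x) = D (U x))
    (hfg : ∀ j : ℤ, Module.Finite ℤ_[ℓ] (gradedCoh X D j))
    (γH : ∀ j : ℤ, gradedCoh X D j →ₗ[ℤ_[ℓ]] gradedCoh X D j)
    (hγH : ∀ (j : ℤ) (x y : ↥(X j ⊓ LinearMap.ker D)), (y : V) = U (x : V) →
      γH j (Submodule.Quotient.mk x) = Submodule.Quotient.mk y)
    (hss : ∀ j : ℤ,
      ((minpoly ℚ_[ℓ] (LinearMap.baseChange ℚ_[ℓ] (γH j))).rootMultiplicity
        ((q : ℚ_[ℓ]) ^ r)) ≤ 1) :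
    letI c : ℤ_[ℓ] := ((uq ^ (-r) : ℤ_[ℓ]ˣ) : ℤ_[ℓ])
    letI CX : ℤ → Submodule ℤ_[ℓ] (V × V) := fun n => (X (n + 1)).prod (X n)
    letI DC : V × V →ₗ[ℤ_[ℓ]] V × V :=
      LinearMap.prod ((-D).comp (LinearMap.fst ℤ_[ℓ] V V))
        (((LinearMap.id - c • (U : V →ₗ[ℤ_[ℓ]] V)).comp (LinearMap.fst ℤ_[ℓ] V V)) +
          D.comp (LinearMap.snd ℤ_[ℓ] V V))
    (∀ j : ℤ, Module.Finite ℤ_[ℓ] (gradedCoh CX DC (j - 1))) ∧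
    Set.Finite {j : ℤ | Nontrivial (gradedCoh CX DC (j - 1))} ∧
    (∑ᶠ j : ℤ, ((j.negOnePow : ℤ) *
      (Module.finrank ℚ_[ℓ] (ℚ_[ℓ] ⊗[ℤ_[ℓ]] gradedCoh CX DC (j - 1)) : ℤ))) = 0 := by
  exact coneAux_main ℓ ((uq ^ (-r) : ℤ_[ℓ]ˣ) : ℤ_[ℓ]) V X n₀ hbdd D hD hDD U hUX hUD hfg γH hγH
    _ (fun _ => rfl) _ (fun _ _ => rfl)
end

section
/- Let ℓ be a prime, q a power of a prime p ≠ ℓ, and r an integer. Let H be a finitely generated ℤ_ℓ-module with an automorphism γ, and let f : Ker(1 − q^{−r}γ : H → H) → Coker(1 − q^{−r}γ : H → H) be the homomorphism induced by the identity map of H (inclusion followed by projection). Then Ker(f) and Coker(f) are both finite if and only if q^r is not a multiple root of the minimal polynomial of γ acting on H ⊗_{ℤ_ℓ} ℚ_ℓ; and in that case z(f) := [Ker(f)]/[Coker(f)] = | ∏_{i : a_i ≠ q^r} (1 − a_i/q^r) |_ℓ, where (a_i)_i is the family of eigenvalues (with multiplicity, in a fixed algebraic closure of ℚ_ℓ)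 of γ acting on H ⊗_{ℤ_ℓ} ℚ_ℓ, and | · |_ℓ is the ℓ-adic absolute value normalized by |ℓ|_ℓ = ℓ^{−1} (the displayed product is Galois-stable, hence lies in ℚ_ℓ). -/
open scoped TensorProduct


theorem aux_card_quot (ℓ : ℕ) [Fact ℓ.Prime] (a : ℤ_[ℓ]) (ha : a ≠ 0) :
    Finite (ℤ_[ℓ] ⧸ Ideal.span ({a} : Set ℤ_[ℓ])) ∧
    ((Nat.card (ℤ_[ℓ] ⧸ Ideal.span ({a} : Set ℤ_[ℓ])) : ℝ))⁻¹ = ‖a‖ := by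
  have h1 : Ideal.span ({a} : Set ℤ_[ℓ]) = RingHom.ker (PadicInt.toZModPow (p := ℓ) a.valuation) := by
    rw [PadicInt.ker_toZModPow]
    apply Ideal.span_singleton_eq_span_singleton.2
    conv_lhs => rw [PadicInt.unitCoeff_spec ha]
    exact (associated_unit_mul_left _ _ (Units.isUnit _))
  have hs : Function.Surjective (PadicInt.toZModPow (p := ℓ) a.valuation) := ZMod.ringHom_surjective _
  have e := (Ideal.quotEquivOfEq h1).trans (RingHom.quotientKerEquivOfSurjective hs)
  have : NeZero (ℓ ^ a.valuation) := ⟨pow_ne_zero _ (Fact.out : ℓ.Prime).ne_zero⟩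
  refine ⟨Finite.of_equiv _ e.symm.toEquiv, ?_⟩
  rw [Nat.card_congr e.toEquiv, Nat.card_zmod, PadicInt.norm_eq_zpow_neg_valuation ha]
  simp

theorem aux_finite_torsion (ℓ : ℕ) [Fact ℓ.Prime] (M : Type) [AddCommGroup M] [Module ℤ_[ℓ] M]
    [Module.Finite ℤ_[ℓ] M] (h : Module.IsTorsion ℤ_[ℓ] M) : Finite M := by
  obtain ⟨a, ha, ha0⟩ := Submodule.annihilator_top_inter_nonZeroDivisors h
  have ha0 : a ≠ 0 := nonZeroDivisors.ne_zero ha0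
  have hT : Module.IsTorsionBySet ℤ_[ℓ] M (Ideal.span ({a} : Set ℤ_[ℓ])) := by
    rw [Module.isTorsionBySet_span_singleton_iff]
    intro x
    exact (Submodule.mem_annihilator.1 ha) x trivial
  let := hT.module
  have := (aux_card_quot ℓ a ha0).1
  have : IsScalarTower ℤ_[ℓ] (ℤ_[ℓ] ⧸ Ideal.span ({a} : Set ℤ_[ℓ])) M := hT.isScalarTower
  have : Module.Finite (ℤ_[ℓ] ⧸ Ideal.span ({a} : Set ℤ_[ℓ])) M :=
    Module.Finite.of_restrictScalars_finite ℤ_[ℓ] _ _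
  exact Module.finite_of_finite (ℤ_[ℓ] ⧸ Ideal.span ({a} : Set ℤ_[ℓ]))

theorem aux_free (ℓ : ℕ) [Fact ℓ.Prime] (M : Type) [AddCommGroup M] [Module ℤ_[ℓ] M]
    [Module.Finite ℤ_[ℓ] M] [Module.Free ℤ_[ℓ] M] (g : M →ₗ[ℤ_[ℓ]] M)
    (hg : Function.Injective g) :
    Finite (M ⧸ LinearMap.range g) ∧
    ((Nat.card (M ⧸ LinearMap.range g) : ℝ))⁻¹ = ‖LinearMap.det g‖ := by
  let N := LinearMap.range g
  let e : M ≃ₗ[ℤ_[ℓ]] N := LinearEquiv.ofInjective g hg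
  let b := Module.Free.chooseBasis ℤ_[ℓ] M
  have h : Module.finrank ℤ_[ℓ] N = Module.finrank ℤ_[ℓ] M := e.symm.finrank_eq
  let a := Submodule.smithNormalFormCoeffs b h
  let b' := Submodule.smithNormalFormTopBasis b h
  let ab := Submodule.smithNormalFormBotBasis b h
  have ab_eq := Submodule.smithNormalFormBotBasis_def b h
  let e' : M ≃ₗ[ℤ_[ℓ]] N := b'.equiv ab (Equiv.refl _)
  let f : M →ₗ[ℤ_[ℓ]] M := N.subtype.comp (e' : M →ₗ[ℤ_[ℓ]] N)
  have hass : Associated (LinearMap.det g) (LinearMap.det f) := by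
    have : g = N.subtype ∘ₗ (e : M →ₗ[ℤ_[ℓ]] N) := by ext x; rfl
    rw [this]
    exact LinearMap.associated_det_comp_equiv _ _ _
  have hnorm : ‖LinearMap.det g‖ = ‖LinearMap.det f‖ := by
    obtain ⟨u, hu⟩ := hass
    rw [← hu, norm_mul, PadicInt.norm_units, mul_one]
  have ha : ∀ i, f (b' i) = a i • b' i := by
    intro i
    change ((b'.equiv ab (Equiv.refl _) (b' i) : N) : M) = _
    rw [b'.equiv_apply, Equiv.refl_apply]
    exact ab_eq i
  have hdet : LinearMap.det f = ∏ i, a i := by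
    rw [← LinearMap.det_toMatrix b', ← Matrix.det_diagonal]
    congr 1; ext i j
    rw [LinearMap.toMatrix_apply, ha, map_smul, Module.Basis.repr_self, Finsupp.smul_single,
      smul_eq_mul, mul_one]
    by_cases h : i = j
    · rw [h, Matrix.diagonal_apply_eq, Finsupp.single_eq_same]
    · rw [Matrix.diagonal_apply_ne _ h, Finsupp.single_eq_of_ne h]
  have hne : ∀ i, a i ≠ 0 := Submodule.smithNormalFormCoeffs_ne_zero b h
  have E := Submodule.quotientEquivPiSpan N b h
  have hf := fun i => (aux_card_quot ℓ (a i) (hne i)).1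
  constructor
  · exact Finite.of_equiv _ E.symm.toEquiv
  · rw [hnorm, hdet, Nat.card_congr E.toEquiv, Nat.card_pi, norm_prod]
    push_cast
    rw [← Finset.prod_inv_distrib]
    exact Finset.prod_congr rfl fun i _ => (aux_card_quot ℓ (a i) (hne i)).2

theorem aux_torsion_equiv (ℓ : ℕ) [Fact ℓ.Prime] (M : Type) [AddCommGroup M] [Module ℤ_[ℓ] M] :
    Function.Bijective (LinearMap.baseChange ℚ_[ℓ] (Submodule.torsion ℤ_[ℓ] M).mkQ) := by
  constructor
  · rw [injective_iff_map_eq_zero]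
    intro x hx
    have hex := lTensor_exact ℚ_[ℓ] (f := (Submodule.torsion ℤ_[ℓ] M).subtype)
      (g := (Submodule.torsion ℤ_[ℓ] M).mkQ) (by
        rw [LinearMap.exact_iff]; simp) (Submodule.mkQ_surjective _)
    obtain ⟨y, rfl⟩ := (hex x).1 hx
    have hz : ∀ y : ℚ_[ℓ] ⊗[ℤ_[ℓ]] (Submodule.torsion ℤ_[ℓ] M), y = 0 := by
      intro y
      induction y with
      | zero => rfl
      | add a b ha hb => rw [ha, hb, add_zero]
      | tmul c t =>
        obtain ⟨a, ha⟩ := (Submodule.torsion_isTorsion (R := ℤ_[ℓ]) (M := M)) (x := t)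
        have ha0 : ((a : ℤ_[ℓ]) : ℚ_[ℓ]) ≠ 0 := by
          have : (a : ℤ_[ℓ]) ≠ 0 := nonZeroDivisors.ne_zero a.2
          exact fun h => this (Subtype.ext h)
        have : c = (a : ℤ_[ℓ]) • (((a : ℤ_[ℓ]) : ℚ_[ℓ])⁻¹ * c) := by
          rw [Algebra.smul_def]
          change c = ((a : ℤ_[ℓ]) : ℚ_[ℓ]) * _
          rw [mul_inv_cancel_left₀ ha0]
        rw [this, TensorProduct.smul_tmul]
        have ha' : (a : ℤ_[ℓ]) • t = 0 := ha
        rw [ha', TensorProduct.tmul_zero]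
    rw [hz y, map_zero]
  · intro y
    obtain ⟨x, hx⟩ := LinearMap.lTensor_surjective ℚ_[ℓ] (Submodule.mkQ_surjective (Submodule.torsion ℤ_[ℓ] M)) y
    exact ⟨x, hx⟩

theorem aux_det (ℓ : ℕ) [Fact ℓ.Prime] (M : Type) [AddCommGroup M] [Module ℤ_[ℓ] M]
    [Module.Finite ℤ_[ℓ] M] (g : M →ₗ[ℤ_[ℓ]] M) 
    (hT : Submodule.torsion ℤ_[ℓ] M ≤ (Submodule.torsion ℤ_[ℓ] M).comap g) :
    LinearMap.det (g.baseChange ℚ_[ℓ]) =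
      ((LinearMap.det ((Submodule.torsion ℤ_[ℓ] M).mapQ _ g hT) : ℤ_[ℓ]) : ℚ_[ℓ]) := by
  let e := LinearEquiv.ofBijective _ (aux_torsion_equiv ℓ M)
  change _ = algebraMap ℤ_[ℓ] ℚ_[ℓ] _
  rw [← LinearMap.det_baseChange, ← LinearMap.det_conj _ e]
  congr 1
  ext x
  have : e.symm (1 ⊗ₜ[ℤ_[ℓ]] (Submodule.mkQ _ x)) = 1 ⊗ₜ x := by
    rw [LinearEquiv.symm_apply_eq]; rfl
  simp [-Submodule.mkQ_apply, this]
  rfl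

theorem aux_main (ℓ : ℕ) [Fact ℓ.Prime] (M : Type) [AddCommGroup M] [Module ℤ_[ℓ] M]
    [Module.Finite ℤ_[ℓ] M] (g : M →ₗ[ℤ_[ℓ]] M) :
    (Finite (LinearMap.ker g) ↔ LinearMap.det (g.baseChange ℚ_[ℓ]) ≠ 0) ∧
    (LinearMap.det (g.baseChange ℚ_[ℓ]) ≠ 0 → Finite (M ⧸ LinearMap.range g) ∧
      (Nat.card (LinearMap.ker g) : ℝ) / Nat.card (M ⧸ LinearMap.range g) =
        ‖LinearMap.det (g.baseChange ℚ_[ℓ])‖) := by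
  set T := Submodule.torsion ℤ_[ℓ] M with hTdef
  have hT : T ≤ T.comap g := by
    rintro x ⟨a, ha⟩
    refine ⟨a, ?_⟩
    change (a : ℤ_[ℓ]) • x = 0 at ha
    change (a : ℤ_[ℓ]) • g x = 0
    rw [← map_smul, ha, map_zero]
  have hTfin : Finite T := aux_finite_torsion ℓ T Submodule.torsion_isTorsion
  rw [aux_det ℓ M g hT]
  set gN := T.mapQ T g hT with hgN
  have hdet : ((LinearMap.det gN : ℤ_[ℓ]) : ℚ_[ℓ]) ≠ 0 ↔ Function.Injective gN := by
    rw [← LinearMap.ker_eq_bot, ← not_iff_not]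
    rw [← ne_eq (LinearMap.ker gN), ← LinearMap.det_eq_zero_iff_ker_ne_bot]
    simp
  rw [hdet]
  have hinj : Function.Injective gN ↔ ∀ x, g x ∈ T → x ∈ T := by
    rw [injective_iff_map_eq_zero]
    constructor
    · intro h x hx
      rw [← Submodule.Quotient.mk_eq_zero]
      apply h
      rw [hgN, Submodule.mapQ_apply, Submodule.Quotient.mk_eq_zero]
      exact hx
    · intro h x hx
      obtain ⟨x, rfl⟩ := Submodule.Quotient.mk_surjective _ x
      rw [hgN, Submodule.mapQ_apply, Submodule.Quotient.mk_eq_zero] at hx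
      rw [Submodule.Quotient.mk_eq_zero]
      exact h x hx
  constructor
  · rw [hinj]
    constructor
    · rintro hf x ⟨a, ha⟩
      change (a : ℤ_[ℓ]) • g x = 0 at ha
      rw [← map_smul] at ha
      have h1 : Nat.card (LinearMap.ker g) • (⟨(a : ℤ_[ℓ]) • x, ha⟩ : LinearMap.ker g) = 0 :=
        card_nsmul_eq_zero'
      have h2 : Nat.card (LinearMap.ker g) • ((a : ℤ_[ℓ]) • x) = 0 := congrArg Subtype.val h1
      have h3 : (Nat.card (LinearMap.ker g) : ℤ_[ℓ]) ≠ 0 := by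
        exact_mod_cast Nat.card_pos.ne'
      refine ⟨⟨(Nat.card (LinearMap.ker g) : ℤ_[ℓ]), mem_nonZeroDivisors_of_ne_zero h3⟩ * a, ?_⟩
      change ((Nat.card (LinearMap.ker g) : ℤ_[ℓ]) * a) • x = 0
      rw [mul_smul, Nat.cast_smul_eq_nsmul, h2]
    · intro h
      have : LinearMap.ker g ≤ T := fun x hx => h x (by
        rw [LinearMap.mem_ker.1 hx]; exact zero_mem _)
      exact Finite.Set.subset (T : Set M) this
  · intro hi
    obtain ⟨hf, hc⟩ := aux_free ℓ _ gN hi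
    have hi' := hinj.1 hi
    let A := (LinearMap.range g).toAddSubgroup
    let B := T.toAddSubgroup
    let gT : T →ₗ[ℤ_[ℓ]] T := g.restrict hT
    have e1 : (A ⊔ B).index = Nat.card ((M ⧸ T) ⧸ LinearMap.range gN) := by
      have : (LinearMap.range gN).toAddSubgroup = A.map (T.mkQ : M →+ M ⧸ T) := by
        ext y
        constructor
        · rintro ⟨x, rfl⟩
          obtain ⟨x, rfl⟩ := Submodule.Quotient.mk_surjective _ x
          exact ⟨g x, ⟨x, rfl⟩, rfl⟩
        · rintro ⟨_, ⟨x, rfl⟩, rfl⟩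
          exact ⟨Submodule.Quotient.mk x, rfl⟩
      change _ = (LinearMap.range gN).toAddSubgroup.index
      rw [this, AddSubgroup.index_map]
      have h1 : (T.mkQ : M →+ M ⧸ T).range = ⊤ :=
        AddMonoidHom.range_eq_top.2 (Submodule.mkQ_surjective T)
      have h2 : (T.mkQ : M →+ M ⧸ T).ker = B := by
        ext x; simp [B, AddMonoidHom.mem_ker]
      rw [h1, h2, AddSubgroup.index_top, mul_one]
    have e2 : A.relIndex (A ⊔ B) = Nat.card (LinearMap.ker g) := by
      rw [sup_comm, AddSubgroup.relIndex_sup_right, AddSubgroup.relIndex]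
      have : A.addSubgroupOf B = (gT : T →+ T).range := by
        ext ⟨x, hx⟩
        constructor
        · rintro ⟨y, hy⟩
          have hy : g y = x := hy
          exact ⟨⟨y, hi' y (hy ▸ hx)⟩, Subtype.ext hy⟩
        · rintro ⟨y, hy⟩
          exact ⟨y, congrArg Subtype.val hy⟩
      rw [this, AddSubgroup.index_range]
      refine Nat.card_congr ⟨fun x => ⟨x.1.1, congrArg Subtype.val x.2⟩,
        fun x => ⟨⟨x.1, hi' x.1 (by rw [LinearMap.mem_ker.1 x.2]; exact zero_mem _)⟩,
          Subtype.ext x.2⟩, fun x => rfl, fun x => rfl⟩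
    have e3 : Nat.card (M ⧸ LinearMap.range g) =
        Nat.card (LinearMap.ker g) * Nat.card ((M ⧸ T) ⧸ LinearMap.range gN) := by
      rw [← e1, ← e2, AddSubgroup.relIndex_mul_index le_sup_left]; rfl
    have hkf : Finite (LinearMap.ker g) := by
      have : LinearMap.ker g ≤ T := fun x hx => hi' x (by
        rw [LinearMap.mem_ker.1 hx]; exact zero_mem _)
      exact Finite.Set.subset (T : Set M) this
    have hk0 : Nat.card (LinearMap.ker g) ≠ 0 := Nat.card_pos.ne'
    have hc0 : Nat.card ((M ⧸ T) ⧸ LinearMap.range gN) ≠ 0 := Nat.card_pos.ne'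
    constructor
    · exact Nat.finite_of_card_ne_zero (by rw [e3]; exact mul_ne_zero hk0 hc0)
    · rw [e3, ← PadicInt.norm_def, ← hc]
      push_cast
      have : (Nat.card (LinearMap.ker g) : ℝ) ≠ 0 := by exact_mod_cast hk0
      field_simp

section
open Polynomial

theorem aux_minpoly {K V : Type} [Field K] [AddCommGroup V] [Module K V] [FiniteDimensional K V]
    (γ : Module.End K V) (a : K) :
    (minpoly K γ).rootMultiplicity a ≤ 1 ↔
      Disjoint (LinearMap.ker (γ - algebraMap K (Module.End K V) a))
        (LinearMap.range (γ - algebraMap K (Module.End K V) a)) := by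
  have hint : IsIntegral K γ := Algebra.IsIntegral.isIntegral γ
  have hP0 : minpoly K γ ≠ 0 := minpoly.ne_zero hint
  set P := minpoly K γ with hP
  set δ := γ - algebraMap K (Module.End K V) a with hδ
  have hX : aeval γ (X - C a) = δ := by simp [hδ]
  obtain ⟨g, hg, hga⟩ := Polynomial.exists_eq_pow_rootMultiplicity_mul_and_not_dvd P hP0 a
  have hga' : g.eval a ≠ 0 := by
    rwa [Polynomial.dvd_iff_isRoot] at hga
  set m := P.rootMultiplicity a with hm
  constructor
  · intro hle
    have hd : aeval γ (g * (X - C a)) = 0 := by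
      apply (minpoly.dvd_iff).1
      rw [← hP, hg, mul_comm]
      apply mul_dvd_mul_left
      conv_rhs => rw [← pow_one (X - C a)]
      exact pow_dvd_pow _ hle
    rw [Submodule.disjoint_def]
    rintro x hx ⟨u, rfl⟩
    rw [map_mul, hX] at hd
    have h1 : aeval γ g (δ u) = 0 := by
      have := congrArg (fun f => f u) hd
      simpa using this
    have h2 : γ (δ u) = a • (δ u) := by
      have : δ (δ u) = 0 := hx
      rw [hδ, LinearMap.sub_apply, sub_eq_zero] at this
      rw [← hδ] at this
      rw [this]; rfl
    have h3 : aeval γ g (δ u) = g.eval a • δ u := 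
      Module.End.aeval_apply_of_mem_apply_eq_smul h2
    rw [h3] at h1
    exact (smul_eq_zero.1 h1).resolve_left hga'
  · intro hd
    by_contra hlt
    push Not at hlt
    obtain ⟨n, hn⟩ := Nat.exists_eq_add_of_le hlt
    have hm1 : m = n + 1 + 1 := by omega
    have hz : aeval γ P = 0 := minpoly.aeval K γ
    have hz' : aeval γ ((X - C a) ^ (n + 1) * g) = 0 := by
      ext v
      rw [Submodule.disjoint_def] at hd
      apply hd
      · rw [LinearMap.mem_ker, ← hX, ← Module.End.mul_apply, ← map_mul]
        have : (X - C a) * ((X - C a) ^ (n + 1) * g) = P := by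
          rw [hg, hm1]; ring
        rw [this, hz]; rfl
      · rw [pow_succ', mul_assoc, map_mul, hX]
        exact ⟨_, rfl⟩
    have := minpoly.dvd K γ hz'
    rw [← hP] at this
    have h5 : (X - C a) ^ m ∣ (X - C a) ^ (n + 1) * g := (Dvd.intro _ hg.symm).trans this
    rw [hm1, pow_succ] at h5
    exact hga ((mul_dvd_mul_iff_left (pow_ne_zero _ (X_sub_C_ne_zero a))).1 h5)

theorem aux_c {K V : Type} [Field K] [AddCommGroup V] [Module K V] [FiniteDimensional K V]
    (γ ψ : Module.End K V) (a : K) (ha : a ≠ 0) (hψ : ψ = 1 - a⁻¹ • γ)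
    (hd : Disjoint (LinearMap.ker ψ) (LinearMap.range ψ))
    (hr : ∀ x ∈ LinearMap.range ψ, ψ x ∈ LinearMap.range ψ) :
    RatFunc.eval (RingHom.id K) a⁻¹
      ((algebraMap (Polynomial K) (RatFunc K) (LinearMap.charpoly γ).reverse) *
        (algebraMap (Polynomial K) (RatFunc K)
          (1 - Polynomial.C a * Polynomial.X)) ^
            (-((LinearMap.charpoly γ).rootMultiplicity a : ℤ))) =
      LinearMap.det (ψ.restrict hr) := by
  have hc : IsCompl (LinearMap.ker ψ) (LinearMap.range ψ) := by
    refine ⟨hd, codisjoint_iff.2 (Submodule.eq_top_of_disjoint _ _ ?_ hd)⟩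
    rw [add_comm, LinearMap.finrank_range_add_finrank_ker]
  have hγ : γ = a • (1 - ψ) := by
    rw [hψ, sub_sub_cancel, smul_smul, mul_inv_cancel₀ ha, one_smul]
  have hrγ : ∀ x ∈ LinearMap.range ψ, γ x ∈ LinearMap.range ψ := by
    intro x hx
    rw [hγ]
    exact Submodule.smul_mem _ _ (Submodule.sub_mem _ hx (hr x hx))
  set W := LinearMap.range ψ
  set N := LinearMap.ker ψ
  set γW := γ.restrict hrγ with hγW
  have hconj : γ = (Submodule.prodEquivOfIsCompl N W hc).conj
      ((algebraMap K (Module.End K N) a).prodMap γW) := by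
    ext v
    obtain ⟨⟨x, y⟩, rfl⟩ := (Submodule.prodEquivOfIsCompl N W hc).surjective v
    have hx : ψ (x : V) = 0 := x.2
    rw [LinearEquiv.conj_apply_apply, LinearEquiv.symm_apply_apply]
    simp only [Submodule.coe_prodEquivOfIsCompl', LinearMap.prodMap_apply, map_add]
    congr 1
    rw [hγ]
    simp [hx]
  have hch : γ.charpoly = (X - C a) ^ (Module.finrank K N) * γW.charpoly := by
    conv_lhs => rw [hconj]
    rw [LinearEquiv.charpoly_conj, LinearMap.charpoly_prodMap]
    congr 1
    have := LinearMap.charpoly_sub_smul (0 : Module.End K N) (-a)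
    rw [LinearMap.charpoly_zero] at this
    convert this using 2
    · ext; simp
    · simp [sub_eq_add_neg]
  have hev : γW.charpoly.eval a = a ^ (Module.finrank K W) * LinearMap.det (ψ.restrict hr) := by
    rw [LinearMap.eval_charpoly, ← LinearMap.det_smul]
    congr 1
    ext x
    simp [hγW, hγ, smul_sub]
  have hdet : LinearMap.det (ψ.restrict hr) ≠ 0 := by
    intro h0
    rw [LinearMap.det_eq_zero_iff_ker_ne_bot] at h0
    apply h0
    rw [LinearMap.ker_eq_bot']
    intro x hx
    apply Subtype.ext
    exact (Submodule.disjoint_def.1 hd) x (congrArg Subtype.val hx) x.2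
  have hne : γW.charpoly.eval a ≠ 0 := by
    rw [hev]; exact mul_ne_zero (pow_ne_zero _ ha) hdet
  have hC0 : γW.charpoly ≠ 0 := fun h => hne (by rw [h]; simp)
  have hrho : γ.charpoly.rootMultiplicity a = Module.finrank K N := by
    rw [hch, Polynomial.rootMultiplicity_mul (mul_ne_zero (pow_ne_zero _ (X_sub_C_ne_zero a)) hC0),
      Polynomial.rootMultiplicity_X_sub_C_pow, Polynomial.rootMultiplicity_eq_zero hne, add_zero]
  have hrev1 : (X - C a : K[X]).reverse = 1 - C a * X := by
    rw [sub_eq_add_neg, ← C_neg, reverse_add_C]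
    have : (X : K[X]).reverse = 1 := by
      have h1 : (1 : K[X]).reverse = 1 := by simpa using reverse_C (1 : K)
      simpa [h1] using reverse_mul_X (1 : K[X])
    simp [sub_eq_add_neg, this]
  have hrevpow : ∀ n : ℕ, ((X - C a : K[X]) ^ n).reverse = (1 - C a * X) ^ n := by
    intro n
    induction n with
    | zero => simpa using reverse_C (1 : K)
    | succ n ih => rw [pow_succ, reverse_mul_of_domain, ih, hrev1, pow_succ]
  have hrev : γ.charpoly.reverse = (1 - C a * X) ^ (Module.finrank K N) * γW.charpoly.reverse := by
    rw [hch, reverse_mul_of_domain, hrevpow]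
  have hD : (1 - C a * X : K[X]) ≠ 0 := by
    rw [← hrev1, ne_eq, reverse_eq_zero]; exact X_sub_C_ne_zero a
  have hD' : algebraMap (Polynomial K) (RatFunc K) (1 - C a * X) ≠ 0 := 
    (map_ne_zero_iff _ (RatFunc.algebraMap_injective K)).2 hD
  rw [hrho, hrev, map_mul, map_pow, zpow_neg, zpow_natCast, mul_right_comm,
    mul_inv_cancel₀ (pow_ne_zero _ hD'), one_mul, RatFunc.eval_algebraMap, Algebra.algebraMap_self_apply, eval₂_id]
  have hinv : Invertible a := invertibleOfNonzero ha
  have := Polynomial.eval₂_reverse_mul_pow (RingHom.id K) a γW.charpoly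
  rw [LinearMap.charpoly_natDegree, invOf_eq_inv, eval₂_id, eval₂_id, hev, mul_comm] at this
  exact mul_left_cancel₀ (pow_ne_zero _ ha) this

end


theorem aux_det_range (ℓ : ℕ) [Fact ℓ.Prime] (H : Type) [AddCommGroup H] [Module ℤ_[ℓ] H]
    [Module.Finite ℤ_[ℓ] H] (φ : H →ₗ[ℤ_[ℓ]] H)
    (hφ : ∀ x ∈ LinearMap.range φ, φ x ∈ LinearMap.range φ)
    (hr : ∀ x ∈ LinearMap.range (φ.baseChange ℚ_[ℓ]),
      φ.baseChange ℚ_[ℓ] x ∈ LinearMap.range (φ.baseChange ℚ_[ℓ])) :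
    LinearMap.det ((φ.restrict hφ).baseChange ℚ_[ℓ]) =
      LinearMap.det ((φ.baseChange ℚ_[ℓ]).restrict hr) := by
  set ψ := φ.baseChange ℚ_[ℓ] with hψ
  let i := (LinearMap.range φ).subtype.baseChange ℚ_[ℓ]
  have hi : Function.Injective i :=
    Module.Flat.lTensor_preserves_injective_linearMap (M := ℚ_[ℓ]) (LinearMap.range φ).subtype
      (Submodule.injective_subtype _)
  have hir : i ∘ₗ (φ.rangeRestrict.baseChange ℚ_[ℓ]) = ψ := by
    rw [hψ, ← LinearMap.baseChange_comp]; rfl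
  have hs : Function.Surjective (φ.rangeRestrict.baseChange ℚ_[ℓ]) :=
    LinearMap.lTensor_surjective ℚ_[ℓ] φ.surjective_rangeRestrict
  have hrange : LinearMap.range i = LinearMap.range ψ := by
    rw [← hir, LinearMap.range_comp, LinearMap.range_eq_top.2 hs, Submodule.map_top]
  let e := (LinearEquiv.ofInjective i hi).trans (LinearEquiv.ofEq _ _ hrange)
  rw [← LinearMap.det_conj _ e]
  congr 1
  have he : ∀ x, ((e x : LinearMap.range ψ) : ℚ_[ℓ] ⊗[ℤ_[ℓ]] H) = i x := fun x => rfl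
  have hcomm : i ∘ₗ ((φ.restrict hφ).baseChange ℚ_[ℓ]) = ψ ∘ₗ i := by
    rw [hψ, ← LinearMap.baseChange_comp, ← LinearMap.baseChange_comp]; rfl
  apply LinearMap.ext
  intro y
  obtain ⟨x, rfl⟩ := e.surjective y
  apply Subtype.ext
  simp only [LinearMap.comp_apply, LinearEquiv.coe_coe, LinearEquiv.symm_apply_apply, he,
    LinearMap.coe_restrict_apply]
  exact LinearMap.congr_fun hcomm x

theorem aux_glue (ℓ : ℕ) [Fact ℓ.Prime] (H : Type) [AddCommGroup H] [Module ℤ_[ℓ] H]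
    (φ : H →ₗ[ℤ_[ℓ]] H)
    (hφ : ∀ x ∈ LinearMap.range φ, φ x ∈ LinearMap.range φ)
    (f : LinearMap.ker φ →ₗ[ℤ_[ℓ]] (H ⧸ LinearMap.range φ))
    (hf : f = (Submodule.mkQ (LinearMap.range φ)).comp (LinearMap.ker φ).subtype) :
    Nonempty (LinearMap.ker f ≃ LinearMap.ker (φ.restrict hφ)) ∧
    Nonempty (((H ⧸ LinearMap.range φ) ⧸ LinearMap.range f) ≃
      (LinearMap.range φ ⧸ LinearMap.range (φ.restrict hφ))) := by
  have hk : ∀ x : LinearMap.ker φ, x ∈ LinearMap.ker f ↔ (x : H) ∈ LinearMap.range φ := by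
    intro x
    rw [LinearMap.mem_ker, hf]
    exact Submodule.Quotient.mk_eq_zero _
  constructor
  · exact ⟨⟨fun x => ⟨⟨x.1.1, (hk _).1 x.2⟩, Subtype.ext x.1.2⟩,
      fun x => ⟨⟨x.1.1, congrArg Subtype.val x.2⟩, (hk _).2 x.1.2⟩, fun x => rfl, fun x => rfl⟩⟩
  · let F : H →ₗ[ℤ_[ℓ]] ((H ⧸ LinearMap.range φ) ⧸ LinearMap.range f) :=
      (Submodule.mkQ _).comp (Submodule.mkQ _)
    let G : H →ₗ[ℤ_[ℓ]] (LinearMap.range φ ⧸ LinearMap.range (φ.restrict hφ)) :=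
      (Submodule.mkQ _).comp φ.rangeRestrict
    have hF : Function.Surjective F :=
      (Submodule.mkQ_surjective _).comp (Submodule.mkQ_surjective _)
    have hG : Function.Surjective G :=
      (Submodule.mkQ_surjective _).comp φ.surjective_rangeRestrict
    have hFG : LinearMap.ker F = LinearMap.ker G := by
      ext x
      have h1 : x ∈ LinearMap.ker F ↔ Submodule.Quotient.mk x ∈ LinearMap.range f :=
        Submodule.Quotient.mk_eq_zero _
      have h2 : x ∈ LinearMap.ker G ↔ φ.rangeRestrict x ∈ LinearMap.range (φ.restrict hφ) :=
        Submodule.Quotient.mk_eq_zero _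
      rw [h1, h2]
      constructor
      · rintro ⟨y, hy⟩
        rw [hf] at hy
        obtain ⟨z, hz⟩ := (Submodule.Quotient.eq _).1 hy
        refine ⟨⟨φ (-z), ⟨-z, rfl⟩⟩, Subtype.ext ?_⟩
        change φ (φ (-z)) = φ x
        have hy0 : φ (y : H) = 0 := y.2
        rw [map_neg, hz]
        simp [hy0]
      · rintro ⟨⟨_, ⟨z, rfl⟩⟩, hz⟩
        have hz : φ (φ z) = φ x := congrArg Subtype.val hz
        refine ⟨⟨x - φ z, by rw [LinearMap.mem_ker, map_sub, hz, sub_self]⟩, ?_⟩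
        rw [hf]
        exact (Submodule.Quotient.eq _).2 ⟨-z, by simp⟩
    exact ⟨((F.quotKerEquivOfSurjective hF).symm.trans ((Submodule.quotEquivOfEq _ _ hFG).trans
      (G.quotKerEquivOfSurjective hG))).toEquiv⟩

/-- Let `ℓ` be a prime, `q` a power of a prime `p ≠ ℓ` (so `q` is a
unit `uq` of `ℤ_ℓ`), `r ∈ ℤ`, and `H` a finitely generated `ℤ_ℓ`-module with an
automorphism `γ`.  Let `f : Ker (1 - q^{-r} γ) → Coker (1 - q^{-r} γ)` be induced by the
identity of `H`.  Then `Ker f` and `Coker f` are finite if and only if `q^r` is not a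
multiple root of the minimal polynomial of `γ` on `H ⊗ ℚ_ℓ`; and in that case
`z(f) = [Ker f]/[Coker f] = |∏_{aᵢ ≠ q^r} (1 - aᵢ/q^r)|_ℓ`, the `aᵢ` being the
eigenvalues of `γ` on `H ⊗ ℚ_ℓ`.  The Galois-stable eigenvalue product is expressed as
the value at `t = q^{-r}` of `det(1 - γ t ∣ H ⊗ ℚ_ℓ) / (1 - q^r t)^ρ`, where
`det(1 - γ t)` is the reverse of the characteristic polynomial of `γ` and `ρ` is the
multiplicity of `q^r` as a root of the characteristic polynomial. -/
theorem z_of_induced_map_eq_eigenvalue_product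
    (ℓ : ℕ) [Fact ℓ.Prime] (p k : ℕ) (hp : p.Prime) (hpℓ : p ≠ ℓ) (hk : 0 < k)
    (q : ℕ) (hq : q = p ^ k) (r : ℤ)
    (uq : ℤ_[ℓ]ˣ) (huq : (uq : ℤ_[ℓ]) = (q : ℤ_[ℓ]))
    (H : Type) [AddCommGroup H] [Module ℤ_[ℓ] H] [Module.Finite ℤ_[ℓ] H]
    (γ : H ≃ₗ[ℤ_[ℓ]] H) :
    letI φ : H →ₗ[ℤ_[ℓ]] H :=
      LinearMap.id - ((uq ^ (-r) : ℤ_[ℓ]ˣ) : ℤ_[ℓ]) • (γ : H →ₗ[ℤ_[ℓ]] H)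
    letI f : LinearMap.ker φ →ₗ[ℤ_[ℓ]] (H ⧸ LinearMap.range φ) :=
      (Submodule.mkQ (LinearMap.range φ)).comp (LinearMap.ker φ).subtype
    letI γQ := LinearMap.baseChange ℚ_[ℓ] (γ : H →ₗ[ℤ_[ℓ]] H)
    letI ρ : ℕ := (LinearMap.charpoly γQ).rootMultiplicity ((q : ℚ_[ℓ]) ^ r)
    letI c : ℚ_[ℓ] := RatFunc.eval (RingHom.id ℚ_[ℓ]) ((q : ℚ_[ℓ]) ^ (-r))
      ((algebraMap (Polynomial ℚ_[ℓ]) (RatFunc ℚ_[ℓ]) (LinearMap.charpoly γQ).reverse) *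
        (algebraMap (Polynomial ℚ_[ℓ]) (RatFunc ℚ_[ℓ])
          (1 - Polynomial.C ((q : ℚ_[ℓ]) ^ r) * Polynomial.X)) ^ (-(ρ : ℤ)))
    (((Finite (LinearMap.ker f) ∧
        Finite ((H ⧸ LinearMap.range φ) ⧸ LinearMap.range f)) ↔
      (minpoly ℚ_[ℓ] γQ).rootMultiplicity ((q : ℚ_[ℓ]) ^ r) ≤ 1) ∧
    ((minpoly ℚ_[ℓ] γQ).rootMultiplicity ((q : ℚ_[ℓ]) ^ r) ≤ 1 →
      ((Nat.card (LinearMap.ker f) : ℝ) /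
          (Nat.card ((H ⧸ LinearMap.range φ) ⧸ LinearMap.range f)) = ‖c‖))) := by
  generalize hφd : (LinearMap.id - ((uq ^ (-r) : ℤ_[ℓ]ˣ) : ℤ_[ℓ]) • (γ : H →ₗ[ℤ_[ℓ]] H) :
    H →ₗ[ℤ_[ℓ]] H) = φ
  generalize hfd : (Submodule.mkQ (LinearMap.range φ)).comp (LinearMap.ker φ).subtype = f
  generalize hγQ : LinearMap.baseChange ℚ_[ℓ] (γ : H →ₗ[ℤ_[ℓ]] H) = γQ
  have hφr : ∀ x ∈ LinearMap.range φ, φ x ∈ LinearMap.range φ := fun x _ => ⟨x, rfl⟩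
  set ψ := φ.baseChange ℚ_[ℓ] with hψ
  have hr : ∀ x ∈ LinearMap.range ψ, ψ x ∈ LinearMap.range ψ := fun x _ => ⟨x, rfl⟩
  have hdet := aux_det_range ℓ H φ hφr hr
  obtain ⟨⟨e1⟩, ⟨e2⟩⟩ := aux_glue ℓ H φ hφr f hfd.symm
  obtain ⟨m1, m2⟩ := aux_main ℓ (LinearMap.range φ) (φ.restrict hφr)
  rw [hdet] at m1 m2
  have hq0 : (q : ℚ_[ℓ]) ≠ 0 := by
    rw [hq]; exact_mod_cast pow_ne_zero k hp.ne_zero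
  set a : ℚ_[ℓ] := (q : ℚ_[ℓ]) ^ r with ha
  have ha0 : a ≠ 0 := zpow_ne_zero _ hq0
  have hu : ((((uq ^ (-r) : ℤ_[ℓ]ˣ) : ℤ_[ℓ])) : ℚ_[ℓ]) = a⁻¹ := by
    have h1 := map_zpow (Units.map (PadicInt.Coe.ringHom (p := ℓ) : ℤ_[ℓ] →* ℚ_[ℓ])) uq (-r)
    have h2 := congrArg Units.val h1
    rw [Units.val_zpow_eq_zpow_val] at h2
    rw [ha, ← zpow_neg]
    refine h2.trans ?_
    congr 1
    change ((uq : ℤ_[ℓ]) : ℚ_[ℓ]) = _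
    rw [huq]; simp
  have hψ' : ψ = 1 - a⁻¹ • γQ := by
    rw [hψ, ← hφd, ← hγQ]
    rw [LinearMap.baseChange_sub, LinearMap.baseChange_smul, LinearMap.baseChange_id, ← hu]
    ext x
    simp
    rfl
  have hψδ : ψ = (-a⁻¹) • (γQ - algebraMap ℚ_[ℓ] (Module.End ℚ_[ℓ] _) a) := by
    rw [hψ', Algebra.algebraMap_eq_smul_one, smul_sub, smul_smul, neg_mul, inv_mul_cancel₀ ha0]
    simp [add_comm, sub_eq_add_neg]
  have hna : -a⁻¹ ≠ 0 := neg_ne_zero.2 (inv_ne_zero ha0)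
  have hmin : (minpoly ℚ_[ℓ] γQ).rootMultiplicity a ≤ 1 ↔
      Disjoint (LinearMap.ker ψ) (LinearMap.range ψ) := by
    rw [aux_minpoly, hψδ, LinearMap.ker_smul _ _ hna, LinearMap.range_smul _ _ hna]
  have hdd : LinearMap.det (ψ.restrict hr) ≠ 0 ↔
      Disjoint (LinearMap.ker ψ) (LinearMap.range ψ) := by
    rw [ne_eq, LinearMap.det_eq_zero_iff_ker_ne_bot, not_not, LinearMap.ker_eq_bot',
      Submodule.disjoint_def]
    constructor
    · intro h x hx hx'
      exact congrArg Subtype.val (h ⟨x, hx'⟩ (Subtype.ext hx))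
    · intro h x hx
      exact Subtype.ext (h x (congrArg Subtype.val hx) x.2)
  rw [hmin, ← hdd]
  refine ⟨⟨fun h => ?_, fun h => ?_⟩, fun h => ?_⟩
  · have := h.1
    exact m1.1 (Finite.of_equiv _ e1)
  · have h1 := m1.2 h
    have h2 := (m2 h).1
    exact ⟨Finite.of_equiv _ e1.symm, Finite.of_equiv _ e2.symm⟩
  · rw [Nat.card_congr e1, Nat.card_congr e2, (m2 h).2]
    congr 1
    have := aux_c γQ ψ a ha0 hψ' (hdd.1 h) hr
    rw [← this, ← zpow_neg]
end

section
/- Let (E^j)_{j∈ℤ} be abelian groups, zero for all but finitely many j. Suppose given for each j abelian groups K^j and C^j, short exact sequences 0 → C^{j−1} → E^j → K^j → 0 (with maps ι^{j−1} : C^{j−1} → E^j and π^j : E^j → K^j), and homomorphisms f^j : K^j → C^j with finite kernel and finite cokernel. Define d^j : E^j → E^{j+1} as the composite ι^j ∘ f^j ∘ π^j. Then d^{j+1} ∘ d^j = 0, each cohomology group H^j = Ker(d^j)/Im(d^{j−1}) of the complex (E^•, d^•) is finite, and the alternating product of their orders satisfies ∏_j [H^j]^{(−1)^j} = ∏_j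 z(f^j)^{(−1)^j}, where z(f^j) = [Ker f^j]/[Coker f^j]. -/
theorem card_aux {E0 K0 A B K C E2 : Type*} [AddCommGroup E0] [AddCommGroup K0]
    [AddCommGroup A] [AddCommGroup B] [AddCommGroup K] [AddCommGroup C] [AddCommGroup E2]
    (q : E0 →+ K0) (g : K0 →+ A) (i : A →+ B) (p : B →+ K) (f : K →+ C) (i2 : C →+ E2)
    (hi : Function.Injective i) (hex : i.range = p.ker) (hp : Function.Surjective p)
    (hi2 : Function.Injective i2) (hq : Function.Surjective q) :
    Nat.card ((i2.comp (f.comp p)).ker ⧸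
      ((i.comp (g.comp q)).range).addSubgroupOf ((i2.comp (f.comp p)).ker)) =
    Nat.card f.ker * Nat.card (A ⧸ g.range) := by
  have h1 : (i2.comp (f.comp p)).ker = f.ker.comap p := by
    ext x
    simp [AddMonoidHom.mem_ker, map_eq_zero_iff i2 hi2]
  have h2 : (i.comp (g.comp q)).range = g.range.map i := by
    ext x
    simp [AddMonoidHom.mem_range, hq.exists]
  rw [h1, h2]
  change (g.range.map i).relIndex (f.ker.comap p) = _ * g.range.index
  have h3 : g.range.map i ≤ p.ker := by
    rw [← hex, AddMonoidHom.range_eq_map i]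
    exact AddSubgroup.map_mono le_top
  have h4 : p.ker ≤ f.ker.comap p := by
    intro x hx
    have : p x = 0 := hx
    simp [this]
  rw [← AddSubgroup.relIndex_mul_relIndex _ _ _ h3 h4, mul_comm]
  congr 1
  · rw [← AddMonoidHom.comap_bot, AddSubgroup.relIndex_comap,
      AddSubgroup.map_comap_eq_self_of_surjective hp, AddSubgroup.relIndex_bot_left]
  · rw [← hex, AddMonoidHom.range_eq_map i, AddSubgroup.relIndex_map_map_of_injective _ _ hi,
      AddSubgroup.relIndex_top_right]

/-- Let `(E^j)` be abelian groups, zero for all but finitely many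
`j`.  Suppose given short exact sequences `0 → C^{j-1} → E^j → K^j → 0` (with maps
`ι^{j-1}` and `π^j`) and homomorphisms `f^j : K^j → C^j` with finite kernel and
cokernel.  Define `d^j : E^j → E^{j+1}` as `ι^j ∘ f^j ∘ π^j`.  Then `d ∘ d = 0`, the
cohomology groups `H^j = Ker d^j / Im d^{j-1}` are finite, and
`∏_j [H^j]^{(-1)^j} = ∏_j z(f^j)^{(-1)^j}` where `z(f) = [Ker f]/[Coker f]`.
(The inclusions `ι` are presented with two indices, `ι i j : C i →+ E j`; only the
components `ι (j-1) j` play a role.) -/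
theorem finite_cohomology_of_ses_complex
    (E K C : ℤ → Type*)
    [∀ j, AddCommGroup (E j)] [∀ j, AddCommGroup (K j)] [∀ j, AddCommGroup (C j)]
    (hEfin : Set.Finite {j : ℤ | Nontrivial (E j)})
    (ι : ∀ i j : ℤ, C i →+ E j) (π : ∀ j : ℤ, E j →+ K j) (f : ∀ j : ℤ, K j →+ C j)
    (hinj : ∀ j : ℤ, Function.Injective (ι (j - 1) j))
    (hexact : ∀ j : ℤ, AddMonoidHom.range (ι (j - 1) j) = AddMonoidHom.ker (π j))
    (hsurj : ∀ j : ℤ, Function.Surjective (π j))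
    (hker : ∀ j : ℤ, Finite (AddMonoidHom.ker (f j)))
    (hcoker : ∀ j : ℤ, Finite (C j ⧸ AddMonoidHom.range (f j))) :
    letI d : ∀ i j : ℤ, E i →+ E j := fun i j => (ι i j).comp ((f i).comp (π i))
    (∀ (i : ℤ) (x : E i), d (i + 1) (i + 1 + 1) (d i (i + 1) x) = 0) ∧
    (∀ j : ℤ, Finite ((AddMonoidHom.ker (d j (j + 1))) ⧸
        (AddMonoidHom.range (d (j - 1) j)).addSubgroupOf (AddMonoidHom.ker (d j (j + 1))))) ∧
    (∏ᶠ j : ℤ, ((Nat.card ((AddMonoidHom.ker (d j (j + 1))) ⧸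
          (AddMonoidHom.range (d (j - 1) j)).addSubgroupOf
            (AddMonoidHom.ker (d j (j + 1)))) : ℝ) ^ (j.negOnePow : ℤ)))
      = ∏ᶠ j : ℤ, (((Nat.card (AddMonoidHom.ker (f j)) : ℝ) /
          (Nat.card (C j ⧸ AddMonoidHom.range (f j)))) ^ (j.negOnePow : ℤ)) := by
  have hinj' : ∀ i j : ℤ, i + 1 = j → Function.Injective (ι i j) := by
    intro i j h
    obtain rfl : i = j - 1 := by omega
    exact hinj j
  have hexact' : ∀ i j : ℤ, i + 1 = j → (ι i j).range = (π j).ker := by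
    intro i j h
    obtain rfl : i = j - 1 := by omega
    exact hexact j
  have hcard : ∀ j : ℤ, Nat.card (((ι j (j+1)).comp ((f j).comp (π j))).ker ⧸
        (((ι (j-1) j).comp ((f (j-1)).comp (π (j-1)))).range).addSubgroupOf
          (((ι j (j+1)).comp ((f j).comp (π j))).ker)) =
      Nat.card (f j).ker * Nat.card (C (j-1) ⧸ (f (j-1)).range) := by
    intro j
    exact card_aux _ _ _ _ _ _ (hinj j) (hexact j) (hsurj j) (hinj' j _ rfl) (hsurj (j-1))
  refine ⟨?_, ?_, ?_⟩
  · intro i x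
    have h : ι i (i+1) (f i (π i x)) ∈ (π (i+1)).ker := by
      rw [← hexact' i (i+1) rfl]
      exact ⟨_, rfl⟩
    have h2 : π (i+1) (ι i (i+1) (f i (π i x))) = 0 := h
    simp [h2]
  · intro j
    have := hker j
    have := hcoker (j-1)
    refine Nat.finite_of_card_ne_zero ?_
    rw [hcard j]
    exact mul_ne_zero Nat.card_pos.ne' Nat.card_pos.ne'
  · have hk1 : ∀ j, ¬ Nontrivial (E j) → Nat.card (f j).ker = 1 := by
      intro j hj
      rw [not_nontrivial_iff_subsingleton] at hj
      have : Subsingleton (K j) := (hsurj j).subsingleton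
      exact Nat.card_unique
    have hc1 : ∀ j, ¬ Nontrivial (E (j+1)) → Nat.card (C j ⧸ (f j).range) = 1 := by
      intro j hj
      rw [not_nontrivial_iff_subsingleton] at hj
      have : Subsingleton (C j) := (hinj' j (j+1) rfl).subsingleton
      have : Subsingleton (C j ⧸ (f j).range) :=
        (QuotientAddGroup.mk_surjective (s := (f j).range)).subsingleton
      exact Nat.card_unique
    simp only [hcard]
    have hS : ∀ a : ℤ → ℝ, (∀ j, ¬ Nontrivial (E j) → a j = 1) →
        (Function.mulSupport a).Finite := by
      intro a ha
      refine hEfin.subset ?_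
      intro j hj
      by_contra h
      exact hj (ha j h)
    have hS' : ∀ a : ℤ → ℝ, (∀ j, ¬ Nontrivial (E (j+1)) → a j = 1) →
        (Function.mulSupport a).Finite := by
      intro a ha
      refine (hEfin.preimage (f := fun j : ℤ => j + 1)
        (fun x _ y _ h => by simpa using h)).subset ?_
      intro j hj
      by_contra h
      exact hj (ha j h)
    simp only [Nat.cast_mul, mul_zpow, div_eq_mul_inv]
    rw [finprod_mul_distrib, finprod_mul_distrib]
    · congr 1
      rw [← finprod_comp_equiv (Equiv.addRight (1:ℤ))]
      refine finprod_congr fun j => ?_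
      have he : ∀ k : ℤ, k = j → (Nat.card (C k ⧸ (f k).range)) = Nat.card (C j ⧸ (f j).range) := by
        rintro k rfl
        rfl
      simp [Int.negOnePow_succ]
      exact congrArg (fun n : ℕ => (n : ℝ) ^ (j.negOnePow : ℤ)) (he (j + 1 - 1) (by omega))
    · exact hS _ fun j hj => by simp only [hk1 j hj, Nat.cast_one, one_zpow]
    · exact hS' _ fun j hj => by simp [hc1 j hj]
    · exact hS _ fun j hj => by simp only [hk1 j hj, Nat.cast_one, one_zpow]
    · exact hS _ fun j hj => by
        have := hc1 (j-1) (by simpa using hj)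
        simp [this]
end
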